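/- arXiv:2212.11241 — 3 statements merged into one kernel-verified Lean document; each statement's English description precedes it below -/
import Mathlib

section
/- Let V and H be real Hilbert spaces with V separable, let e : V → H be a continuous injective linear map with dense range, and let A : V → V* be a bounded linear operator into the continuous dual of V satisfying the coercivity condition: there exists c > 0 such that (A v)(v) + ‖e v‖_H² ≥ c‖v‖_V² for all v ∈ V. Fix T > 0. Then for every u₀ ∈ H there exists a strongly measurable u : [0,T] → V with ∫₀ᵀ ‖u(t)‖_V² dt < ∞ such that for every test function φ : [0,T] → V which is strongly measurable with ∫₀ᵀ ‖φ(t)‖_V² dt < ∞ and for which there exists g ∈ L²((0,T); H) with e(φ(t)) = e(φ(0)) + ∫₀ᵗ g(s) ds for all t ∈ [0,T] and with e(φ(T)) = 0, one has −∫₀ᵀ ⟨e(u(t)), g(t)⟩_H dt + ∫₀ᵀ (A u(t))(φ(t)) dt = ⟨u₀, e(φ(0))⟩_H. Moreover u is unique: any two such solutions agree for almost every t ∈ (0,T). -/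
open MeasureTheory
open scoped RealInnerProductSpace

/-- `u : ℝ → V` is a weak solution on `[0,T]` of the abstract Cauchy problem
`u_t + A u = 0`, `u(0) = u₀`, in the Gelfand-triple setting given by the embedding
`e : V →L[ℝ] H`: `u` is strongly measurable with `∫₀ᵀ ‖u(t)‖_V² dt < ∞` and the
weak formulation holds against every admissible test function `φ` whose
`H`-valued time derivative is `g ∈ L²((0,T);H)` and with `e(φ(T)) = 0`. -/
def IsAbstractWeakSolution
    {V H : Type*} [NormedAddCommGroup V] [InnerProductSpace ℝ V]
    [NormedAddCommGroup H] [InnerProductSpace ℝ H] [CompleteSpace H]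
    (e : V →L[ℝ] H) (A : V →L[ℝ] (V →L[ℝ] ℝ)) (T : ℝ) (u₀ : H)
    (u : ℝ → V) : Prop :=
  StronglyMeasurable u ∧
  IntegrableOn (fun t => ‖u t‖ ^ 2) (Set.Ioc 0 T) ∧
  ∀ (φ : ℝ → V) (g : ℝ → H),
    StronglyMeasurable φ →
    IntegrableOn (fun t => ‖φ t‖ ^ 2) (Set.Ioc 0 T) →
    StronglyMeasurable g →
    IntegrableOn (fun t => ‖g t‖ ^ 2) (Set.Ioc 0 T) →
    (∀ t ∈ Set.Icc (0 : ℝ) T, e (φ t) = e (φ 0) + ∫ s in (0 : ℝ)..t, g s) →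
    e (φ T) = 0 →
    -(∫ t in Set.Ioc (0 : ℝ) T, ⟪e (u t), g t⟫)
        + (∫ t in Set.Ioc (0 : ℝ) T, A (u t) (φ t))
      = ⟪u₀, e (φ 0)⟫

namespace AbsolutelyContinuousOnInterval

open Filter

variable {X Y E F G : Type*} [PseudoMetricSpace X] [PseudoMetricSpace Y]
  [NormedAddCommGroup E] [NormedSpace ℝ E] [NormedAddCommGroup F] [NormedSpace ℝ F]
  [NormedAddCommGroup G] [NormedSpace ℝ G] {a b : ℝ}

theorem of_dist_le {f : ℝ → X} {g : ℝ → Y} (hg : AbsolutelyContinuousOnInterval g a b)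
    (h : ∀ s ∈ Set.uIcc a b, ∀ t ∈ Set.uIcc a b, dist (f s) (f t) ≤ dist (g s) (g t)) :
    AbsolutelyContinuousOnInterval f a b := by
  unfold AbsolutelyContinuousOnInterval at hg ⊢
  refine squeeze_zero' (.of_forall fun _ ↦ Finset.sum_nonneg fun _ _ ↦ dist_nonneg) ?_ hg
  rw [eventually_inf_principal]
  filter_upwards with I hI
  exact Finset.sum_le_sum fun i hi ↦ h _ (hI.1 i hi).1 _ (hI.1 i hi).2

/-- The primitive of an integrable vector-valued function is absolutely continuous. -/
theorem intervalIntegral [CompleteSpace E] {f : ℝ → E} (hf : IntervalIntegrable f volume a b) :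
    AbsolutelyContinuousOnInterval (fun t ↦ ∫ s in a..t, f s) a b := by
  refine (hf.norm.absolutelyContinuousOnInterval_intervalIntegral Set.left_mem_uIcc).of_dist_le
    fun s hs t ht ↦ ?_
  have hint {r : ℝ} (hr : r ∈ Set.uIcc a b) : IntervalIntegrable f volume a r :=
    hf.mono_set (Set.uIcc_subset_uIcc_left hr)
  rw [dist_comm, dist_eq_norm, intervalIntegral.integral_interval_sub_left (hint ht) (hint hs),
    dist_comm, Real.dist_eq,
    intervalIntegral.integral_interval_sub_left (hint ht).norm (hint hs).norm]
  exact intervalIntegral.norm_integral_le_abs_integral_norm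

theorem bilin (B : E →L[ℝ] F →L[ℝ] G) {f : ℝ → E} {g : ℝ → F}
    (hf : AbsolutelyContinuousOnInterval f a b) (hg : AbsolutelyContinuousOnInterval g a b) :
    AbsolutelyContinuousOnInterval (fun t ↦ B (f t) (g t)) a b := by
  obtain ⟨C, hC⟩ := hf.exists_bound
  obtain ⟨D, hD⟩ := hg.exists_bound
  unfold AbsolutelyContinuousOnInterval at hf hg ⊢
  refine squeeze_zero' (.of_forall fun _ ↦ Finset.sum_nonneg fun _ _ ↦ dist_nonneg) ?_
    (by simpa using (hg.const_mul (‖B‖ * C)).add (hf.const_mul (‖B‖ * D)))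
  rw [eventually_inf_principal]
  filter_upwards with I hI
  simp only [Finset.mul_sum, ← Finset.sum_add_distrib]
  refine Finset.sum_le_sum fun i hi ↦ ?_
  set s := (I.2 i).1
  set t := (I.2 i).2
  have hs := hC s (hI.1 i hi).1
  have ht := hD t (hI.1 i hi).2
  have hsplit : B (f s) (g s) - B (f t) (g t) = B (f s) (g s - g t) + B (f s - f t) (g t) := by
    simp
  rw [dist_eq_norm, dist_eq_norm, dist_eq_norm, hsplit]
  calc ‖B (f s) (g s - g t) + B (f s - f t) (g t)‖
      ≤ ‖B‖ * ‖f s‖ * ‖g s - g t‖ + ‖B‖ * ‖f s - f t‖ * ‖g t‖ :=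
        (norm_add_le _ _).trans (add_le_add (B.le_opNorm₂ _ _) (B.le_opNorm₂ _ _))
    _ ≤ ‖B‖ * C * ‖g s - g t‖ + ‖B‖ * ‖f s - f t‖ * D := by gcongr
    _ = ‖B‖ * C * ‖g s - g t‖ + ‖B‖ * D * ‖f s - f t‖ := by ring

/-- The fundamental theorem of calculus for an absolutely continuous function with a prescribed
almost everywhere derivative. -/
theorem intervalIntegrable_and_integral_eq_sub {f f' : ℝ → ℝ}
    (hf : AbsolutelyContinuousOnInterval f a b)
    (hf' : ∀ᵐ t, t ∈ Set.uIcc a b → HasDerivAt f (f' t) t) :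
    IntervalIntegrable f' volume a b ∧ ∫ t in a..b, f' t = f b - f a := by
  have hae : ∀ᵐ t, t ∈ Set.uIoc a b → deriv f t = f' t := by
    filter_upwards [hf'] with t ht htm using (ht (Set.uIoc_subset_uIcc htm)).deriv
  refine ⟨hf.intervalIntegrable_deriv.congr_ae ?_, ?_⟩
  · exact (ae_restrict_iff' measurableSet_uIoc).2 hae
  · rw [← hf.integral_deriv_eq_sub]
    exact intervalIntegral.integral_congr_ae (hae.mono fun t ht h ↦ (ht h).symm)

end AbsolutelyContinuousOnInterval

section Primitives

variable {E F : Type*} [NormedAddCommGroup E] [NormedSpace ℝ E] [CompleteSpace E]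
  [NormedAddCommGroup F] [NormedSpace ℝ F] [CompleteSpace F] {a b : ℝ}

theorem absolutelyContinuousOnInterval_of_eq_add_integral {f f' : ℝ → E}
    (hf' : IntervalIntegrable f' volume a b)
    (hf : ∀ t ∈ Set.uIcc a b, f t = f a + ∫ s in a..t, f' s) :
    AbsolutelyContinuousOnInterval f a b := by
  refine (AbsolutelyContinuousOnInterval.intervalIntegral hf').of_dist_le fun s hs t ht ↦ ?_
  rw [hf s hs, hf t ht, dist_add_left]

theorem ae_hasDerivAt_of_eq_add_integral {f f' : ℝ → E}
    (hf' : IntervalIntegrable f' volume a b)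
    (hf : ∀ t ∈ Set.uIcc a b, f t = f a + ∫ s in a..t, f' s) :
    ∀ᵐ t, t ∈ Set.uIoo a b → HasDerivAt f (f' t) t := by
  filter_upwards [hf'.ae_hasDerivAt_integral] with t ht hmem
  refine ((ht (Set.uIoo_subset_uIcc_self hmem) a Set.left_mem_uIcc).const_add
    (f a)).congr_of_eventuallyEq ?_
  filter_upwards [isOpen_Ioo.mem_nhds hmem] with s hs using hf s (Set.uIoo_subset_uIcc_self hs)

theorem ae_mem_uIoo_of_mem_uIcc (a b : ℝ) :
    ∀ᵐ t : ℝ, t ∈ Set.uIcc a b → t ∈ Set.uIoo a b := by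
  filter_upwards [Measure.ae_ne volume a, Measure.ae_ne volume b] with t hta htb ht
  rcases le_total a b with h | h
  · simp only [Set.uIcc_of_le h, Set.uIoo_of_le h, Set.mem_Icc, Set.mem_Ioo] at *
    exact ⟨lt_of_le_of_ne ht.1 (Ne.symm hta), lt_of_le_of_ne ht.2 htb⟩
  · simp only [Set.uIcc_of_ge h, Set.uIoo_of_ge h, Set.mem_Icc, Set.mem_Ioo] at *
    exact ⟨lt_of_le_of_ne ht.1 (Ne.symm htb), lt_of_le_of_ne ht.2 hta⟩

/-- Integration by parts for a continuous bilinear form applied to two primitives. -/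
theorem intervalIntegrable_and_integral_bilin_eq_sub (B : E →L[ℝ] F →L[ℝ] ℝ)
    {f f' : ℝ → E} {g g' : ℝ → F}
    (hf' : IntervalIntegrable f' volume a b)
    (hf : ∀ t ∈ Set.uIcc a b, f t = f a + ∫ s in a..t, f' s)
    (hg' : IntervalIntegrable g' volume a b)
    (hg : ∀ t ∈ Set.uIcc a b, g t = g a + ∫ s in a..t, g' s) :
    IntervalIntegrable (fun t ↦ B (f t) (g' t) + B (f' t) (g t)) volume a b ∧
      ∫ t in a..b, (B (f t) (g' t) + B (f' t) (g t)) = B (f b) (g b) - B (f a) (g a) := by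
  refine AbsolutelyContinuousOnInterval.intervalIntegrable_and_integral_eq_sub
    (.bilin B (absolutelyContinuousOnInterval_of_eq_add_integral hf' hf)
      (absolutelyContinuousOnInterval_of_eq_add_integral hg' hg)) ?_
  filter_upwards [ae_hasDerivAt_of_eq_add_integral hf' hf, ae_hasDerivAt_of_eq_add_integral hg' hg,
    ae_mem_uIoo_of_mem_uIcc a b] with t hft hgt hmem ht
  exact B.hasDerivAt_of_bilinear (fun _ ↦ hft (hmem ht)) (fun _ ↦ hgt (hmem ht))

/-- The energy identity with exponential weight. -/
theorem intervalIntegrable_and_integral_exp_mul_energy {H : Type*} [NormedAddCommGroup H]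
    [InnerProductSpace ℝ H] [CompleteSpace H] (k : ℝ) {f f' : ℝ → H}
    (hf' : IntervalIntegrable f' volume a b)
    (hf : ∀ t ∈ Set.uIcc a b, f t = f a + ∫ s in a..t, f' s) :
    IntervalIntegrable (fun t ↦ Real.exp (k * t) * (2 * ⟪f t, f' t⟫ + k * ‖f t‖ ^ 2)) volume a b ∧
      ∫ t in a..b, Real.exp (k * t) * (2 * ⟪f t, f' t⟫ + k * ‖f t‖ ^ 2) =
        Real.exp (k * b) * ‖f b‖ ^ 2 - Real.exp (k * a) * ‖f a‖ ^ 2 := by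
  have hac := absolutelyContinuousOnInterval_of_eq_add_integral hf' hf
  have hexp : AbsolutelyContinuousOnInterval (fun t ↦ Real.exp (k * t)) a b :=
    ContDiffOn.absolutelyContinuousOnInterval (by fun_prop)
  have hsq : AbsolutelyContinuousOnInterval (fun t ↦ ‖f t‖ ^ 2) a b := by
    simp only [← real_inner_self_eq_norm_sq]
    exact .bilin (innerSL ℝ) hac hac
  refine (hexp.fun_mul hsq).intervalIntegrable_and_integral_eq_sub ?_
  filter_upwards [ae_hasDerivAt_of_eq_add_integral hf' hf, ae_mem_uIoo_of_mem_uIcc a b]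
    with t hft hmem ht
  have hd : HasDerivAt (fun t ↦ Real.exp (k * t)) (Real.exp (k * t) * k) t := by
    simpa using ((hasDerivAt_id t).const_mul k).exp
  convert! hd.mul (hft (hmem ht)).norm_sq using 1
  ring

end Primitives

/-- If `|ℓ p| ≤ C ‖K p‖`, the functional `ℓ` is represented through `K` by some vector. -/
theorem exists_inner_map_eq_of_abs_le {P E : Type*} [AddCommGroup P] [Module ℝ P]
    [NormedAddCommGroup E] [InnerProductSpace ℝ E] [CompleteSpace E]
    (K : P →ₗ[ℝ] E) (ℓ : P →ₗ[ℝ] ℝ) (C : ℝ) (h : ∀ p, |ℓ p| ≤ C * ‖K p‖) :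
    ∃ u : E, ∀ p, ⟪u, K p⟫ = ℓ p := by
  have hker : LinearMap.ker K ≤ LinearMap.ker ℓ := fun p hp ↦ by
    have := h p
    rw [LinearMap.mem_ker.1 hp, norm_zero, mul_zero] at this
    exact abs_nonpos_iff.1 this
  let f : LinearMap.range K →ₗ[ℝ] ℝ :=
    (LinearMap.ker K).liftQ ℓ hker ∘ₗ K.quotKerEquivRange.symm.toLinearMap
  have hf (p : P) : f ⟨K p, LinearMap.mem_range_self K p⟩ = ℓ p := by
    have : K.quotKerEquivRange.symm ⟨K p, LinearMap.mem_range_self K p⟩ =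
        (LinearMap.ker K).mkQ p := K.quotKerEquivRange_symm_apply_image p _
    simp [f, this]
  have hbound (y : LinearMap.range K) : ‖f y‖ ≤ C * ‖y‖ := by
    obtain ⟨_, p, rfl⟩ := y
    rw [hf]
    exact h p
  obtain ⟨F, hF, -⟩ := exists_extension_norm_eq _ (f.mkContinuous C hbound)
  refine ⟨(InnerProductSpace.toDual ℝ E).symm F, fun p ↦ ?_⟩
  rw [InnerProductSpace.toDual_symm_apply, ← hf p]
  exact hF ⟨K p, LinearMap.mem_range_self K p⟩

section GelfandTriple

variable {V H : Type*} [NormedAddCommGroup V] [InnerProductSpace ℝ V]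
  [NormedAddCommGroup H] [InnerProductSpace ℝ H]

theorem MeasureTheory.MemLp.intervalIntegrable_of_mem_Icc {E : Type*} [NormedAddCommGroup E]
    {f : ℝ → E} {T t : ℝ} (hf : MemLp f 2 (volume.restrict (Set.Ioc 0 T)))
    (ht : t ∈ Set.Icc 0 T) : IntervalIntegrable f volume 0 t := by
  rw [intervalIntegrable_iff_integrableOn_Ioc_of_le ht.1]
  exact IntegrableOn.mono_set (hf.integrable one_le_two) (Set.Ioc_subset_Ioc_right ht.2)

theorem MeasureTheory.MemLp.integrable_bilin {E F : Type*} [NormedAddCommGroup E]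
    [NormedSpace ℝ E] [NormedAddCommGroup F] [NormedSpace ℝ F] (B : E →L[ℝ] F →L[ℝ] ℝ)
    {α : Type*} [MeasurableSpace α] {μ : Measure α} {f : α → E} {g : α → F}
    (hf : MemLp f 2 μ) (hg : MemLp g 2 μ) : Integrable (fun x ↦ B (f x) (g x)) μ :=
  memLp_one_iff_integrable.1 (B.memLp_of_bilin 1 hf hg)

theorem memLp_two_of_integrableOn_sq {E : Type*} [NormedAddCommGroup E] {f : ℝ → E} {s : Set ℝ}
    (hf : StronglyMeasurable f) (hf2 : IntegrableOn (fun t ↦ ‖f t‖ ^ 2) s) :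
    MemLp f 2 (volume.restrict s) :=
  (memLp_two_iff_integrable_sq_norm hf.aestronglyMeasurable).2 hf2

theorem integrableOn_sq_of_memLp_two {E : Type*} [NormedAddCommGroup E] {f : ℝ → E} {s : Set ℝ}
    (hf : MemLp f 2 (volume.restrict s)) : IntegrableOn (fun t ↦ ‖f t‖ ^ 2) s :=
  (memLp_two_iff_integrable_sq_norm hf.1).1 hf

/-- The admissible test functions `φ`, paired with a time derivative `g` of `e ∘ φ`. -/
def testPairs (e : V →L[ℝ] H) (T : ℝ) : Submodule ℝ ((ℝ → V) × (ℝ → H)) where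
  carrier := {p | MemLp p.1 2 (volume.restrict (Set.Ioc 0 T)) ∧
    MemLp p.2 2 (volume.restrict (Set.Ioc 0 T)) ∧
    (∀ t ∈ Set.Icc 0 T, e (p.1 t) = e (p.1 0) + ∫ s in (0 : ℝ)..t, p.2 s) ∧ e (p.1 T) = 0}
  zero_mem' := ⟨MemLp.zero, MemLp.zero, by simp, by simp⟩
  add_mem' := by
    rintro p q ⟨hp₁, hp₂, hp, hpT⟩ ⟨hq₁, hq₂, hq, hqT⟩
    refine ⟨hp₁.add hq₁, hp₂.add hq₂, fun t ht ↦ ?_, by simp [hpT, hqT]⟩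
    simp only [Prod.fst_add, Prod.snd_add, Pi.add_apply, map_add]
    rw [intervalIntegral.integral_add (hp₂.intervalIntegrable_of_mem_Icc ht)
      (hq₂.intervalIntegrable_of_mem_Icc ht), hp t ht, hq t ht]
    abel
  smul_mem' := by
    rintro r p ⟨hp₁, hp₂, hp, hpT⟩
    refine ⟨hp₁.const_smul r, hp₂.const_smul r, fun t ht ↦ ?_, by simp [hpT]⟩
    simp only [Prod.smul_fst, Prod.smul_snd, Pi.smul_apply, map_smul]
    rw [intervalIntegral.integral_smul, hp t ht, smul_add]

variable [CompleteSpace V] [CompleteSpace H]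

/-- The formal adjoint `-e*g + A*φ` of `∂ₜ + A`, identified with a `V`-valued function. -/
noncomputable def adjointField (e : V →L[ℝ] H) (A : V →L[ℝ] (V →L[ℝ] ℝ)) :
    V × H →L[ℝ] V :=
  ((InnerProductSpace.toDual ℝ V).symm.toContinuousLinearEquiv.toContinuousLinearMap ∘L
    A.flip).coprod (-ContinuousLinearMap.adjoint e)

theorem inner_adjointField (e : V →L[ℝ] H) (A : V →L[ℝ] (V →L[ℝ] ℝ)) (u v : V) (h : H) :
    ⟪u, adjointField e A (v, h)⟫ = -⟪e u, h⟫ + A u v := by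
  have hA : ⟪u, (InnerProductSpace.toDual ℝ V).symm (A.flip v)⟫ = A u v := by
    rw [real_inner_comm, InnerProductSpace.toDual_symm_apply, ContinuousLinearMap.flip_apply]
  simp [adjointField, inner_add_right, inner_neg_right, ContinuousLinearMap.adjoint_inner_right,
    hA, add_comm]

theorem memLp_adjointField (e : V →L[ℝ] H) (A : V →L[ℝ] (V →L[ℝ] ℝ)) {μ : Measure ℝ}
    {φ : ℝ → V} {g : ℝ → H} (hφ : MemLp φ 2 μ) (hg : MemLp g 2 μ) :
    MemLp (fun t ↦ adjointField e A (φ t, g t)) 2 μ := by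
  have h := (ContinuousLinearMap.comp_memLp' (adjointField e A ∘L .inl ℝ V H) hφ).add
    (ContinuousLinearMap.comp_memLp' (adjointField e A ∘L .inr ℝ V H) hg)
  refine (memLp_congr_ae (.of_forall fun t ↦ ?_)).1 h
  simp [← map_add]

/-- `adjointField` acting on test pairs with values in `L²(0,T;V)`. -/
noncomputable def adjointOperator (e : V →L[ℝ] H) (A : V →L[ℝ] (V →L[ℝ] ℝ)) (T : ℝ) :
    testPairs e T →ₗ[ℝ] Lp V 2 (volume.restrict (Set.Ioc 0 T)) where
  toFun p := (memLp_adjointField e A p.2.1 p.2.2.1).toLp _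
  map_add' p q := by
    rw [← MemLp.toLp_add]
    congr 1
    ext t
    exact map_add (adjointField e A) (p.1.1 t, p.1.2 t) (q.1.1 t, q.1.2 t)
  map_smul' r p := by
    rw [RingHom.id_apply, ← MemLp.toLp_const_smul]
    congr 1
    ext t
    exact map_smul (adjointField e A) r (p.1.1 t, p.1.2 t)

variable (e : V →L[ℝ] H) (A : V →L[ℝ] (V →L[ℝ] ℝ)) {c T : ℝ}

theorem norm_sq_adjointOperator (p : testPairs e T) :
    ‖adjointOperator e A T p‖ ^ 2 =
      ∫ t in Set.Ioc 0 T, ‖adjointField e A (p.1.1 t, p.1.2 t)‖ ^ 2 := by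
  rw [← real_inner_self_eq_norm_sq, L2.inner_def]
  refine integral_congr_ae ?_
  filter_upwards [(memLp_adjointField e A p.2.1 p.2.2.1).coeFn_toLp] with t ht
  rw [real_inner_self_eq_norm_sq]
  exact congrArg (‖·‖ ^ 2) ht

/-- The a priori estimate for the backward problem. -/
theorem norm_sq_initial_le (hc : 0 < c) (hcoer : ∀ v : V, c * ‖v‖ ^ 2 ≤ A v v + ‖e v‖ ^ 2)
    (hT : 0 < T) (p : testPairs e T) :
    ‖e (p.1.1 0)‖ ^ 2 ≤ Real.exp (2 * T) / (2 * c) * ‖adjointOperator e A T p‖ ^ 2 := by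
  obtain ⟨⟨φ, g⟩, hφ, hg, hφg, hφT⟩ := p
  rw [norm_sq_adjointOperator]
  dsimp only at *
  obtain ⟨hint, hval⟩ := intervalIntegrable_and_integral_exp_mul_energy (a := 0) (b := T) 2
    (f := fun t ↦ e (φ t)) (hg.intervalIntegrable_of_mem_Icc (Set.right_mem_Icc.2 hT.le))
    (by rwa [Set.uIcc_of_le hT.le])
  rw [intervalIntegral.integral_of_le hT.le] at hval
  rw [intervalIntegrable_iff_integrableOn_Ioc_of_le hT.le] at hint
  simp only [hφT, mul_zero, Real.exp_zero, norm_zero, one_mul, zero_sub, ne_eq,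
    OfNat.ofNat_ne_zero, not_false_eq_true, zero_pow] at hval
  rw [← neg_eq_iff_eq_neg, ← integral_neg] at hval
  rw [← hval, ← integral_const_mul]
  refine setIntegral_mono_on hint.neg
    ((integrableOn_sq_of_memLp_two (memLp_adjointField e A hφ hg)).const_mul _)
    measurableSet_Ioc fun t ht ↦ ?_
  have hinner := inner_adjointField e A (φ t) (φ t) (g t)
  set k := adjointField e A (φ t, g t)
  have hk : ⟪φ t, k⟫ ≤ c * ‖φ t‖ ^ 2 + ‖k‖ ^ 2 / (4 * c) := by
    refine (real_inner_le_norm _ _).trans ?_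
    have : c * ‖φ t‖ ^ 2 + ‖k‖ ^ 2 / (4 * c) - ‖φ t‖ * ‖k‖ =
        (2 * c * ‖φ t‖ - ‖k‖) ^ 2 / (4 * c) := by
      field_simp
      ring
    have : 0 ≤ (2 * c * ‖φ t‖ - ‖k‖) ^ 2 / (4 * c) := by positivity
    linarith
  have hmain : -(2 * ⟪e (φ t), g t⟫ + 2 * ‖e (φ t)‖ ^ 2) ≤ ‖k‖ ^ 2 / (2 * c) := by
    have : ‖k‖ ^ 2 / (2 * c) = 2 * (‖k‖ ^ 2 / (4 * c)) := by field_simp; norm_num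
    linarith [hcoer (φ t)]
  calc -(Real.exp (2 * t) * (2 * ⟪e (φ t), g t⟫ + 2 * ‖e (φ t)‖ ^ 2))
      = Real.exp (2 * t) * -(2 * ⟪e (φ t), g t⟫ + 2 * ‖e (φ t)‖ ^ 2) := by ring
    _ ≤ Real.exp (2 * t) * (‖k‖ ^ 2 / (2 * c)) := by gcongr
    _ ≤ Real.exp (2 * T) * (‖k‖ ^ 2 / (2 * c)) := by gcongr; exact ht.2
    _ = Real.exp (2 * T) / (2 * c) * ‖k‖ ^ 2 := by ring

variable {e A}

omit [CompleteSpace V] [CompleteSpace H] in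
theorem integrableOn_inner_and_apply {u φ : ℝ → V} {g : ℝ → H}
    (hu : MemLp u 2 (volume.restrict (Set.Ioc 0 T)))
    (hφ : MemLp φ 2 (volume.restrict (Set.Ioc 0 T)))
    (hg : MemLp g 2 (volume.restrict (Set.Ioc 0 T))) :
    IntegrableOn (fun t ↦ ⟪e (u t), g t⟫) (Set.Ioc 0 T) ∧
      IntegrableOn (fun t ↦ A (u t) (φ t)) (Set.Ioc 0 T) :=
  ⟨(e.comp_memLp' hu).integrable_bilin (innerSL ℝ) hg, hu.integrable_bilin A hφ⟩

theorem exists_isAbstractWeakSolution (hc : 0 < c)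
    (hcoer : ∀ v : V, c * ‖v‖ ^ 2 ≤ A v v + ‖e v‖ ^ 2) (hT : 0 < T) (u₀ : H) :
    ∃ u : ℝ → V, IsAbstractWeakSolution e A T u₀ u := by
  let ℓ : testPairs e T →ₗ[ℝ] ℝ :=
    (innerSL ℝ u₀ ∘L e).toLinearMap ∘ₗ LinearMap.proj 0 ∘ₗ LinearMap.fst ℝ _ _ ∘ₗ
      (testPairs e T).subtype
  have hℓ (p : testPairs e T) : ℓ p = ⟪u₀, e (p.1.1 0)⟫ := rfl
  obtain ⟨u, hu⟩ := exists_inner_map_eq_of_abs_le (adjointOperator e A T) ℓ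
    (‖u₀‖ * √(Real.exp (2 * T) / (2 * c))) fun p ↦ by
      rw [hℓ, mul_assoc]
      refine (abs_real_inner_le_norm _ _).trans ?_
      gcongr
      rw [← Real.sqrt_sq (norm_nonneg (adjointOperator e A T p)), ← Real.sqrt_mul (by positivity)]
      exact Real.le_sqrt_of_sq_le (norm_sq_initial_le e A hc hcoer hT p)
  have hu2 : MemLp u 2 (volume.restrict (Set.Ioc 0 T)) := Lp.memLp u
  refine ⟨u, Lp.stronglyMeasurable u, integrableOn_sq_of_memLp_two hu2,
    fun φ g hφm hφ hgm hg hφg hφT ↦ ?_⟩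
  have hφ2 := memLp_two_of_integrableOn_sq hφm hφ
  have hg2 := memLp_two_of_integrableOn_sq hgm hg
  have hint := integrableOn_inner_and_apply (e := e) (A := A) hu2 hφ2 hg2
  have huφ := hu ⟨(φ, g), hφ2, hg2, hφg, hφT⟩
  rw [hℓ, L2.inner_def] at huφ
  refine Eq.trans ?_ huφ
  rw [← integral_neg]
  refine (integral_add hint.1.neg hint.2).symm.trans ?_
  refine integral_congr_ae ?_
  filter_upwards [(memLp_adjointField e A hφ2 hg2).coeFn_toLp] with t ht
  exact (inner_adjointField e A (u t) (φ t) (g t)).symm.trans (congrArg (inner ℝ (u t)) ht.symm)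

theorem ae_eq_zero_of_primitive_eq_zero {E : Type*} [NormedAddCommGroup E] [NormedSpace ℝ E]
    [CompleteSpace E] {w : ℝ → E} (hw : IntervalIntegrable w volume 0 T)
    (h : ∀ t ∈ Set.Icc 0 T, ∫ s in (0 : ℝ)..t, w s = 0) :
    ∀ᵐ t ∂(volume.restrict (Set.Ioc 0 T)), w t = 0 := by
  rcases le_total T 0 with hT | hT
  · simp [Set.Ioc_eq_empty_of_le hT]
  rw [ae_restrict_iff' measurableSet_Ioc]
  filter_upwards [ae_hasDerivAt_of_eq_add_integral (f := fun t ↦ ∫ s in (0 : ℝ)..t, w s) hw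
    (by simp), ae_mem_uIoo_of_mem_uIcc 0 T] with t ht hmem htm
  rw [Set.uIcc_of_le hT, Set.uIoo_of_le hT] at *
  have htm' := hmem ⟨htm.1.le, htm.2⟩
  refine (ht htm').unique ((hasDerivAt_const t (0 : E)).congr_of_eventuallyEq ?_)
  filter_upwards [isOpen_Ioo.mem_nhds htm'] with s hs using h s ⟨hs.1.le, hs.2.le⟩

/-- A function in `L²(0,T;V)` annihilated by all test pairs vanishes almost everywhere. -/
theorem ae_eq_zero_of_forall_testPairs (hc : 0 < c)
    (hcoer : ∀ v : V, c * ‖v‖ ^ 2 ≤ A v v + ‖e v‖ ^ 2) (hT : 0 < T) {w : ℝ → V}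
    (hw : Integrable w)
    (h : ∀ (φ : ℝ → V) (g : ℝ → H), Continuous φ → Continuous g →
      (∀ t, e (φ t) = e (φ 0) + ∫ s in (0 : ℝ)..t, g s) → φ T = 0 →
      -(∫ t in Set.Ioc 0 T, ⟪e (w t), g t⟫) + ∫ t in Set.Ioc 0 T, A (w t) (φ t) = 0) :
    ∀ᵐ t ∂(volume.restrict (Set.Ioc 0 T)), w t = 0 := by
  have hwi (s t : ℝ) : IntervalIntegrable w volume s t := hw.intervalIntegrable
  let W : ℝ → V := fun t ↦ ∫ s in (0 : ℝ)..t, w s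
  have hW0 : W 0 = 0 := intervalIntegral.integral_same
  have hW : Continuous W := intervalIntegral.continuous_primitive hwi 0
  let ψ : ℝ → V := fun t ↦ Real.exp (-2 * t) • W t
  have hψ : Continuous ψ := by fun_prop
  have hψi (s t : ℝ) : IntervalIntegrable ψ volume s t := hψ.intervalIntegrable s t
  let φ : ℝ → V := fun t ↦ ∫ s in t..T, ψ s
  have hφT : φ T = 0 := intervalIntegral.integral_same
  have hφ : ∀ t, φ t = φ 0 + ∫ s in (0 : ℝ)..t, -ψ s := fun t ↦ by
    rw [intervalIntegral.integral_neg, ← sub_eq_add_neg, eq_sub_iff_add_eq, add_comm]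
    exact intervalIntegral.integral_add_adjacent_intervals (hψi 0 t) (hψi t T)
  have hφc : Continuous φ := by
    rw [funext hφ]
    exact continuous_const.add
      (intervalIntegral.continuous_primitive (fun s t ↦ (hψi s t).neg) 0)
  have hweak := h φ (fun t ↦ e (-ψ t)) hφc (by fun_prop) (fun t ↦ by
    rw [hφ t, map_add]
    exact congrArg _ (e.intervalIntegral_comp_comm (hψi 0 t).neg).symm) hφT
  obtain ⟨hparts, hparts_val⟩ := intervalIntegrable_and_integral_bilin_eq_sub A (a := 0) (b := T)
    (f := W) (f' := w) (g := φ) (g' := fun t ↦ -ψ t) (hwi 0 T)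
    (fun t _ ↦ by rw [hW0, zero_add]) (hψi 0 T).neg (fun t _ ↦ hφ t)
  obtain ⟨hen, hen_val⟩ := intervalIntegrable_and_integral_exp_mul_energy (a := 0) (b := T) (-2)
    (f := fun t ↦ e (W t)) (f' := fun t ↦ e (w t))
    (e.integrable_comp hw).intervalIntegrable
    (fun t _ ↦ by rw [e.intervalIntegral_comp_comm (hwi 0 t), hW0, map_zero, zero_add])
  have hci {f : ℝ → ℝ} (hf : Continuous f) : IntervalIntegrable f volume 0 T :=
    hf.intervalIntegrable 0 T
  have hA : Continuous fun t ↦ Real.exp (-2 * t) * A (W t) (W t) := by fun_prop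
  have he : Continuous fun t ↦ Real.exp (-2 * t) * ‖e (W t)‖ ^ 2 := by fun_prop
  have hwAi : IntervalIntegrable (fun t ↦ A (w t) (φ t)) volume 0 T :=
    (hparts.add (hci hA)).congr (fun t _ ↦ by simp [ψ])
  have hwei : IntervalIntegrable (fun t ↦ Real.exp (-2 * t) * ⟪e (W t), e (w t)⟫) volume 0 T :=
    ((hen.add ((hci he).const_mul 2)).const_mul (1 / 2)).congr (fun t _ ↦ by simp; ring)
  have hparts' : (∫ t in (0 : ℝ)..T, A (w t) (φ t)) =
      ∫ t in (0 : ℝ)..T, Real.exp (-2 * t) * A (W t) (W t) := by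
    rw [hφT, hW0, map_zero, map_zero, zero_apply, sub_zero] at hparts_val
    rw [← sub_eq_zero, ← intervalIntegral.integral_sub hwAi (hci hA)]
    refine Eq.trans ?_ hparts_val
    exact intervalIntegral.integral_congr fun t _ ↦ by simp [ψ]; ring
  have hinner : (∫ t in (0 : ℝ)..T, ⟪e (w t), e (-ψ t)⟫) =
      -∫ t in (0 : ℝ)..T, Real.exp (-2 * t) * ⟪e (W t), e (w t)⟫ := by
    rw [← intervalIntegral.integral_neg]
    exact intervalIntegral.integral_congr fun t _ ↦ by
      simp [ψ, inner_neg_right, inner_smul_right, real_inner_comm]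
  have henergy : 0 ≤ 2 * (∫ t in (0 : ℝ)..T, Real.exp (-2 * t) * ⟪e (W t), e (w t)⟫) -
      2 * ∫ t in (0 : ℝ)..T, Real.exp (-2 * t) * ‖e (W t)‖ ^ 2 := by
    rw [← intervalIntegral.integral_const_mul, ← intervalIntegral.integral_const_mul,
      ← intervalIntegral.integral_sub (hwei.const_mul 2) ((hci he).const_mul 2)]
    calc 0 ≤ Real.exp (-2 * T) * ‖e (W T)‖ ^ 2 := by positivity
      _ = _ := by
        rw [hW0, map_zero, norm_zero, zero_pow two_ne_zero, mul_zero, sub_zero] at hen_val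
        rw [← hen_val]
        exact intervalIntegral.integral_congr fun t _ ↦ by simp; ring
  have hWc : Continuous fun t ↦ Real.exp (-2 * t) * (c * ‖W t‖ ^ 2) := by fun_prop
  have hle : (∫ t in (0 : ℝ)..T, Real.exp (-2 * t) * (c * ‖W t‖ ^ 2)) ≤ 0 := by
    calc (∫ t in (0 : ℝ)..T, Real.exp (-2 * t) * (c * ‖W t‖ ^ 2))
        ≤ ∫ t in (0 : ℝ)..T, (Real.exp (-2 * t) * A (W t) (W t) +
            Real.exp (-2 * t) * ‖e (W t)‖ ^ 2) := by
          refine intervalIntegral.integral_mono_on hT.le (hci hWc) (hci (hA.add he)) fun t _ ↦ ?_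
          rw [← mul_add]
          gcongr
          exact hcoer _
      _ ≤ 0 := by
          rw [intervalIntegral.integral_add (hci hA) (hci he)]
          rw [← intervalIntegral.integral_of_le hT.le, ← intervalIntegral.integral_of_le hT.le,
            hinner, hparts'] at hweak
          linarith
  refine ae_eq_zero_of_primitive_eq_zero (hwi 0 T) fun t ht ↦ ?_
  by_contra hne
  have hpos : 0 < ‖W t‖ := norm_pos_iff.2 hne
  exact hle.not_gt (intervalIntegral.integral_pos hT hWc.continuousOn
    (fun s _ ↦ by positivity) ⟨t, ht, by positivity⟩)

/-- Weak solutions agree almost everywhere. -/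
theorem IsAbstractWeakSolution.ae_eq (hc : 0 < c)
    (hcoer : ∀ v : V, c * ‖v‖ ^ 2 ≤ A v v + ‖e v‖ ^ 2) (hT : 0 < T) {u₀ : H} {u₁ u₂ : ℝ → V}
    (h₁ : IsAbstractWeakSolution e A T u₀ u₁) (h₂ : IsAbstractWeakSolution e A T u₀ u₂) :
    ∀ᵐ t ∂(volume.restrict (Set.Ioc (0 : ℝ) T)), u₁ t = u₂ t := by
  have hu₁ := memLp_two_of_integrableOn_sq h₁.1 h₁.2.1
  have hu₂ := memLp_two_of_integrableOn_sq h₂.1 h₂.2.1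
  let w := (Set.Ioc 0 T).indicator (u₁ - u₂)
  have hw : Integrable w :=
    (integrable_indicator_iff measurableSet_Ioc).2 ((hu₁.sub hu₂).integrable one_le_two)
  have hwt {t : ℝ} (ht : t ∈ Set.Ioc 0 T) : w t = u₁ t - u₂ t := Set.indicator_of_mem ht _
  have hzero := ae_eq_zero_of_forall_testPairs hc hcoer hT hw fun φ g hφ hg hφg hφT ↦ by
    have hφ2 : IntegrableOn (fun t ↦ ‖φ t‖ ^ 2) (Set.Ioc 0 T) :=
      (by fun_prop : Continuous fun t ↦ ‖φ t‖ ^ 2).integrableOn_Ioc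
    have hg2 : IntegrableOn (fun t ↦ ‖g t‖ ^ 2) (Set.Ioc 0 T) :=
      (by fun_prop : Continuous fun t ↦ ‖g t‖ ^ 2).integrableOn_Ioc
    have hφm := hφ.stronglyMeasurable
    have hgm := hg.stronglyMeasurable
    have heq₁ := h₁.2.2 φ g hφm hφ2 hgm hg2 (fun t _ ↦ hφg t) (by simp [hφT])
    have heq₂ := h₂.2.2 φ g hφm hφ2 hgm hg2 (fun t _ ↦ hφg t) (by simp [hφT])
    have hφL := memLp_two_of_integrableOn_sq hφm hφ2
    have hgL := memLp_two_of_integrableOn_sq hgm hg2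
    have hint₁ := integrableOn_inner_and_apply (e := e) (A := A) hu₁ hφL hgL
    have hint₂ := integrableOn_inner_and_apply (e := e) (A := A) hu₂ hφL hgL
    have hinner : (∫ t in Set.Ioc 0 T, ⟪e (w t), g t⟫) =
        (∫ t in Set.Ioc 0 T, ⟪e (u₁ t), g t⟫) - ∫ t in Set.Ioc 0 T, ⟪e (u₂ t), g t⟫ := by
      rw [← integral_sub hint₁.1 hint₂.1]
      refine setIntegral_congr_fun measurableSet_Ioc fun t ht ↦ ?_
      simp [hwt ht, inner_sub_left]
    have hA : (∫ t in Set.Ioc 0 T, A (w t) (φ t)) =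
        (∫ t in Set.Ioc 0 T, A (u₁ t) (φ t)) - ∫ t in Set.Ioc 0 T, A (u₂ t) (φ t) := by
      rw [← integral_sub hint₁.2 hint₂.2]
      refine setIntegral_congr_fun measurableSet_Ioc fun t ht ↦ ?_
      simp [hwt ht]
    rw [hinner, hA]
    linarith
  filter_upwards [hzero, ae_restrict_mem measurableSet_Ioc] with t ht hmem
  rw [hwt hmem] at ht
  exact sub_eq_zero.1 ht

end GelfandTriple

/-- Existence and uniqueness of weak solutions of the abstract Cauchy problem
`u_t + Au = 0`, `u(0) = u₀`, for a coercive bounded operator `A : V → V*` in a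
Gelfand triple `V ⊂ H ⊂ V*` with `V` a separable Hilbert space. -/
theorem abstract_cauchy_existence_uniqueness
    {V H : Type*} [NormedAddCommGroup V] [InnerProductSpace ℝ V] [CompleteSpace V]
    [TopologicalSpace.SeparableSpace V]
    [NormedAddCommGroup H] [InnerProductSpace ℝ H] [CompleteSpace H]
    (e : V →L[ℝ] H) (he_inj : Function.Injective e) (he_dense : DenseRange e)
    (A : V →L[ℝ] (V →L[ℝ] ℝ))
    (c : ℝ) (hc : 0 < c)
    (hcoer : ∀ v : V, c * ‖v‖ ^ 2 ≤ A v v + ‖e v‖ ^ 2)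
    (T : ℝ) (hT : 0 < T) (u₀ : H) :
    (∃ u : ℝ → V, IsAbstractWeakSolution e A T u₀ u) ∧
      (∀ u₁ u₂ : ℝ → V, IsAbstractWeakSolution e A T u₀ u₁ →
        IsAbstractWeakSolution e A T u₀ u₂ →
        ∀ᵐ t ∂(volume.restrict (Set.Ioc (0 : ℝ) T)), u₁ t = u₂ t) := by
  exact ⟨exists_isAbstractWeakSolution hc hcoer hT u₀,
    fun _ _ h₁ h₂ ↦ h₁.ae_eq hc hcoer hT h₂⟩
end

section
/- Let V and H be real Hilbert spaces with V separable, let e : V → H be a continuous injective linear map with dense range, and let A : V → V* be a bounded linear operator into the continuous dual of V satisfying: there exists c > 0 such that (A v)(v) + ‖e v‖_H² ≥ c‖v‖_V² for all v ∈ V. Fix T > 0 and u₀ ∈ H, and let u : [0,T] → V be a weak solution of the abstract Cauchy problem, i.e., u is strongly measurable with ∫₀ᵀ ‖u(t)‖_V² dt < ∞ and for every strongly measurable φ : [0,T] → V with ∫₀ᵀ ‖φ(t)‖_V² dt < ∞, for which there exists g ∈ L²((0,T); H) with e(φ(t)) = e(φ(0)) + ∫₀ᵗ g(s) ds for all t and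 e(φ(T)) = 0, one has −∫₀ᵀ ⟨e(u(t)), g(t)⟩_H dt + ∫₀ᵀ (A u(t))(φ(t)) dt = ⟨u₀, e(φ(0))⟩_H. Then there exists a continuous function ū : [0,T] → H with ū(t) = e(u(t)) for almost every t ∈ (0,T), ū(0) = u₀, and the energy equality (1/2)‖ū(t)‖_H² + ∫₀ᵗ (A u(s))(u(s)) ds = (1/2)‖u₀‖_H² holds for every t ∈ [0,T]. -/
open MeasureTheory
open scoped RealInnerProductSpace

open Filter Topology ContinuousLinearMap

/-- A function whose increments are dominated by those of an absolutely continuous function is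
absolutely continuous. -/
lemma AbsolutelyContinuousOnInterval.of_dist_le_s1 {X Y : Type*} [PseudoMetricSpace X]
    [PseudoMetricSpace Y] {φ : ℝ → X} {f : ℝ → Y} {a b C : ℝ}
    (hφ : AbsolutelyContinuousOnInterval φ a b)
    (hf : ∀ x ∈ Set.uIcc a b, ∀ y ∈ Set.uIcc a b, dist (f x) (f y) ≤ C * dist (φ x) (φ y)) :
    AbsolutelyContinuousOnInterval f a b := by
  have h := Tendsto.const_mul C hφ
  rw [mul_zero] at h
  refine squeeze_zero' (.of_forall fun E => Finset.sum_nonneg fun _ _ => dist_nonneg) ?_ h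
  rw [eventually_inf_principal]
  filter_upwards with E hE
  rw [Finset.mul_sum]
  exact Finset.sum_le_sum fun i hi => hf _ (hE.1 i hi).1 _ (hE.1 i hi).2

/-- Fundamental theorem of calculus for the squared norm of a primitive of an integrable
function. -/
lemma norm_sq_add_integral_eq {H : Type*} [NormedAddCommGroup H] [InnerProductSpace ℝ H]
    [CompleteSpace H] {g : ℝ → H} {a b : ℝ} (hg : IntervalIntegrable g volume a b) (p₀ : H) :
    ‖p₀ + ∫ s in a..b, g s‖ ^ 2
      = ‖p₀‖ ^ 2 + 2 * ∫ t in a..b, ⟪p₀ + ∫ s in a..t, g s, g t⟫ := by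
  set p : ℝ → H := fun t => p₀ + ∫ s in a..t, g s with hp
  have hsub : ∀ x ∈ Set.uIcc a b, ∀ y ∈ Set.uIcc a b, IntervalIntegrable g volume x y :=
    fun x hx y hy => hg.mono_set (Set.uIcc_subset_uIcc hx hy)
  have hcont : ContinuousOn p (Set.uIcc a b) :=
    continuousOn_const.add (intervalIntegral.continuousOn_primitive_interval' hg (by simp))
  obtain ⟨M, hM⟩ := isCompact_uIcc.exists_bound_of_continuousOn hcont
  have hac : AbsolutelyContinuousOnInterval (fun t => ‖p t‖ ^ 2) a b := by
    refine (hg.norm.absolutelyContinuousOnInterval_intervalIntegral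
      (c := a) (by simp)).of_dist_le_s1 (C := 2 * M) fun x hx y hy => ?_
    have hxa := hsub a (by simp) x hx
    have hya := hsub a (by simp) y hy
    have h1 : p x - p y = ∫ s in y..x, g s := by
      simp only [hp, add_sub_add_left_eq_sub]
      exact intervalIntegral.integral_interval_sub_left hxa hya
    have h2 : ‖p x - p y‖ ≤ dist (∫ s in a..x, ‖g s‖) (∫ s in a..y, ‖g s‖) := by
      rw [h1, Real.dist_eq, intervalIntegral.integral_interval_sub_left hxa.norm hya.norm]
      exact intervalIntegral.norm_integral_le_abs_integral_norm
    calc dist (‖p x‖ ^ 2) (‖p y‖ ^ 2) = |‖p x‖ - ‖p y‖| * (‖p x‖ + ‖p y‖) := by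
          rw [Real.dist_eq, sq_sub_sq, abs_mul, mul_comm,
            abs_of_nonneg (by positivity : 0 ≤ ‖p x‖ + ‖p y‖)]
      _ ≤ ‖p x - p y‖ * (M + M) := by
          gcongr
          exacts [abs_norm_sub_norm_le _ _, hM x hx, hM y hy]
      _ ≤ 2 * M * dist (∫ s in a..x, ‖g s‖) (∫ s in a..y, ‖g s‖) := by
          have hM0 : 0 ≤ M := (norm_nonneg _).trans (hM x hx)
          nlinarith
  have hderiv : ∫ t in a..b, deriv (fun t => ‖p t‖ ^ 2) t = ∫ t in a..b, 2 * ⟪p t, g t⟫ := by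
    refine intervalIntegral.integral_congr_ae ?_
    filter_upwards [hg.ae_hasDerivAt_integral] with t ht hmem
    exact (((ht (Set.uIoc_subset_uIcc hmem) a (by simp)).const_add p₀).norm_sq).deriv
  rw [hac.integral_deriv_eq_sub, intervalIntegral.integral_const_mul] at hderiv
  simp only [hp, intervalIntegral.integral_same, add_zero] at hderiv ⊢
  linarith

/-- Contractions converging strongly to the identity on a dense set converge strongly to the
identity everywhere. -/
lemma tendsto_apply_of_denseRange {ι E F : Type*} [NormedAddCommGroup F] [NormedSpace ℝ F]
    {l : Filter ι} {Q : ι → F →L[ℝ] F} {g : E → F} (hg : DenseRange g)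
    (hQ : ∀ i x, ‖Q i x‖ ≤ ‖x‖) (hlim : ∀ v, Tendsto (fun i => Q i (g v)) l (𝓝 (g v))) (x : F) :
    Tendsto (fun i => Q i x) l (𝓝 x) := by
  rw [Metric.tendsto_nhds]
  intro ε hε
  obtain ⟨v, hv⟩ := hg.exists_dist_lt x (show 0 < ε / 3 by positivity)
  filter_upwards [Metric.tendsto_nhds.1 (hlim v) (ε / 3) (by positivity)] with i hi
  have h1 : dist (Q i x) (Q i (g v)) ≤ dist x (g v) := by
    simpa [dist_eq_norm, map_sub] using hQ i (x - g v)
  have h2 := dist_triangle4 (Q i x) (Q i (g v)) (g v) x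
  rw [dist_comm (g v) x] at h2
  linarith

section Resolvent

variable {V H : Type*} [NormedAddCommGroup V] [InnerProductSpace ℝ V] [CompleteSpace V]
  [NormedAddCommGroup H] [InnerProductSpace ℝ H] [CompleteSpace H]

/-- The operator `e† e + ε` has a bounded symmetric inverse for `ε > 0`. -/
lemma exists_symmetric_inverse (e : V →L[ℝ] H) {ε : ℝ} (hε : 0 < ε) :
    ∃ S : V →L[ℝ] V, (∀ x y, ⟪S x, y⟫ = ⟪x, S y⟫) ∧
      (∀ x, adjoint e (e (S x)) + ε • S x = x) ∧ ∀ x, S (adjoint e (e x)) + ε • S x = x := by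
  let R : V →L[ℝ] V := adjoint e ∘L e + ε • ContinuousLinearMap.id ℝ V
  have hR : ∀ x, R x = adjoint e (e x) + ε • x := fun x => rfl
  have hRsymm : ∀ x y, ⟪R x, y⟫ = ⟪x, R y⟫ := fun x y => by
    simp [hR, inner_add_left, inner_add_right, inner_smul_left, inner_smul_right,
      adjoint_inner_left, adjoint_inner_right]
  let B : V →L[ℝ] V →L[ℝ] ℝ := innerSL ℝ ∘L R
  have hB : IsCoercive B := by
    refine ⟨ε, hε, fun x => ?_⟩
    have : B x x = ‖e x‖ ^ 2 + ε * (‖x‖ * ‖x‖) := by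
      change ⟪adjoint e (e x) + ε • x, x⟫ = _
      rw [inner_add_left, real_inner_smul_left, adjoint_inner_left, real_inner_self_eq_norm_sq,
        real_inner_self_eq_norm_mul_norm]
    nlinarith [sq_nonneg ‖e x‖]
  let L := hB.continuousLinearEquivOfBilin
  have hL : ∀ x, L x = R x := fun x =>
    ext_inner_right ℝ fun w => by
      rw [IsCoercive.continuousLinearEquivOfBilin_apply]; rfl
  have hRS : ∀ x, R (L.symm x) = x := fun x => by rw [← hL]; simp
  have hSR : ∀ x, L.symm (R x) = x := fun x => by rw [← hL]; simp
  refine ⟨L.symm, fun x y => ?_, fun x => hRS x, fun x => ?_⟩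
  · change ⟪L.symm x, y⟫ = ⟪x, L.symm y⟫
    conv_lhs => rw [← hRS y]
    rw [← hRsymm, hRS]
  · have := hSR x
    rwa [hR, map_add, map_smul] at this

/-- A sequence of bounded symmetric operators `S n` on `V` which approximate the inverse of
`e† e`, in the sense that `S n e† e` and `e S n e†` are contractions converging strongly to the
identity. -/
lemma exists_approximate_inverse (e : V →L[ℝ] H) (he_inj : Function.Injective e)
    (he_dense : DenseRange e) :
    ∃ S : ℕ → V →L[ℝ] V, (∀ n x y, ⟪S n x, y⟫ = ⟪x, S n y⟫) ∧
      (∀ n x, ‖S n (adjoint e (e x))‖ ≤ ‖x‖) ∧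
      (∀ x, Tendsto (fun n => S n (adjoint e (e x))) atTop (𝓝 x)) ∧
      ∀ h, Tendsto (fun n => e (S n (adjoint e h))) atTop (𝓝 h) := by
  have hpos : ∀ n : ℕ, 0 < 1 / ((n : ℝ) + 1) := fun n => by positivity
  choose S hsymm hinv hinv' using fun n : ℕ => exists_symmetric_inverse e (hpos n)
  have hV : ∀ n x, ‖S n (adjoint e (e x))‖ ≤ ‖x‖ := fun n x => by
    set y := S n (adjoint e (e x)) with hy
    have h1 : adjoint e (e (x - y)) = (1 / ((n : ℝ) + 1)) • y := by
      rw [map_sub, map_sub, sub_eq_iff_eq_add', hinv]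
    have h2 : 0 ≤ (1 / ((n : ℝ) + 1)) * ⟪y, x - y⟫ := by
      rw [← real_inner_smul_left, ← h1, adjoint_inner_left]
      exact real_inner_self_nonneg
    have h3 := nonneg_of_mul_nonneg_right h2 (hpos n)
    rw [inner_sub_right, real_inner_self_eq_norm_sq] at h3
    have h4 := real_inner_le_norm y x
    by_contra! hlt
    nlinarith [norm_nonneg x, norm_nonneg y]
  have hH : ∀ n h, ‖e (S n (adjoint e h))‖ ≤ ‖h‖ := fun n h => by
    set y := S n (adjoint e h) with hy
    have h1 : adjoint e (e y) + (1 / ((n : ℝ) + 1)) • y = adjoint e h := hinv n _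
    have h2 : ‖e y‖ ^ 2 + (1 / ((n : ℝ) + 1)) * ‖y‖ ^ 2 = ⟪h, e y⟫ := by
      rw [← adjoint_inner_left, ← h1, inner_add_left, adjoint_inner_left, inner_smul_left,
        real_inner_self_eq_norm_sq, real_inner_self_eq_norm_sq]
      rfl
    have h3 := real_inner_le_norm h (e y)
    have h4 : 0 ≤ (1 / ((n : ℝ) + 1)) * ‖y‖ ^ 2 := by positivity
    by_contra! hlt
    nlinarith [norm_nonneg h, norm_nonneg (e y)]
  have hdense : DenseRange fun x => adjoint e (e x) := by
    change DenseRange (adjoint e ∘L e)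
    have hker : (adjoint e ∘L e).ker = ⊥ := by
      rw [LinearMap.ker_eq_bot']
      intro x hx
      apply he_inj
      rw [map_zero, ← inner_self_eq_zero (𝕜 := ℝ), ← adjoint_inner_left]
      have hx' : adjoint e (e x) = 0 := hx
      rw [hx', inner_zero_left]
    have hself : adjoint (adjoint e ∘L e) = adjoint e ∘L e := by
      rw [adjoint_comp, adjoint_adjoint]
    have := (adjoint e ∘L e).orthogonal_range
    rw [hself, hker] at this
    exact (Submodule.dense_iff_topologicalClosure_eq_top (s := (adjoint e ∘L e).range)).2
      ((Submodule.topologicalClosure_eq_top_iff).2 this)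
  have hlimV : ∀ x, Tendsto (fun n => S n (adjoint e (e x))) atTop (𝓝 x) := by
    refine tendsto_apply_of_denseRange (Q := fun n => S n ∘L adjoint e ∘L e) hdense hV fun v => ?_
    rw [tendsto_iff_norm_sub_tendsto_zero]
    have hz : Tendsto (fun n : ℕ => (1 / ((n : ℝ) + 1)) * ‖v‖) atTop (𝓝 0) := by
      simpa using tendsto_one_div_add_atTop_nhds_zero_nat.mul_const ‖v‖
    refine squeeze_zero (fun _ => norm_nonneg _) (fun n => ?_) hz
    have h1 := hinv' n (adjoint e (e v))
    change ‖S n (adjoint e (e (adjoint e (e v)))) - adjoint e (e v)‖ ≤ _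
    rw [norm_sub_rev, sub_eq_iff_eq_add'.2 h1.symm, norm_smul, Real.norm_of_nonneg (hpos n).le]
    exact mul_le_mul_of_nonneg_left (hV n v) (hpos n).le
  refine ⟨S, hsymm, hV, hlimV, ?_⟩
  exact tendsto_apply_of_denseRange (Q := fun n => e ∘L S n ∘L adjoint e) he_dense hH
    fun v => (e.continuous.tendsto _).comp (hlimV v)

end Resolvent

/-- The fundamental lemma in twice-integrated form: if `∫₀ᵗ k + ∫₀ᵗ (t - s) f(s) ds = t k₀` for all
`t ∈ [0, T]`, then `k(t) + ∫₀ᵗ f = k₀` for almost every `t`. -/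
lemma ae_add_integral_eq_of_integral_eq {E : Type*} [NormedAddCommGroup E] [NormedSpace ℝ E]
    [CompleteSpace E] {k f : ℝ → E} {k₀ : E} {T : ℝ} (hT : 0 ≤ T)
    (hk : IntervalIntegrable k volume 0 T) (hf : IntervalIntegrable f volume 0 T)
    (h : ∀ t ∈ Set.Icc 0 T, (∫ s in (0 : ℝ)..t, k s) + (∫ s in (0 : ℝ)..t, (t - s) • f s)
      = t • k₀) :
    ∀ᵐ t, t ∈ Set.Ioc 0 T → k t + ∫ s in (0 : ℝ)..t, f s = k₀ := by
  have hsf : IntervalIntegrable (fun s => s • f s) volume 0 T :=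
    hf.continuousOn_smul continuousOn_id
  have hne : ∀ᵐ t : ℝ, t ≠ T := by simp [ae_iff, measure_singleton]
  filter_upwards [hk.ae_hasDerivAt_integral, hf.ae_hasDerivAt_integral,
    hsf.ae_hasDerivAt_integral, hne] with t hkt hft hsft htT ht
  have ht' : t ∈ Set.uIcc 0 T := by rw [Set.uIcc_of_le hT]; exact ⟨ht.1.le, ht.2⟩
  have h0 : (0 : ℝ) ∈ Set.uIcc 0 T := by simp
  have hd := ((hkt ht' 0 h0).add
    (((hasDerivAt_id t).fun_smul (hft ht' 0 h0)).sub (hsft ht' 0 h0))).sub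
      ((hasDerivAt_id t).smul_const k₀)
  have hzero : HasDerivAt (fun _ : ℝ => (0 : E)) 0 t := hasDerivAt_const t 0
  have heq := hd.unique (hzero.congr_of_eventuallyEq ?_)
  · simp only [id_eq, one_smul] at heq
    rw [← sub_eq_zero, ← heq]
    abel
  · filter_upwards [Ioo_mem_nhds ht.1 (lt_of_le_of_ne ht.2 htT)] with τ hτ
    have hsub : Set.uIcc 0 τ ⊆ Set.uIcc 0 T := by
      rw [Set.uIcc_of_le hT, Set.uIcc_of_le hτ.1.le]
      exact Set.Icc_subset_Icc_right hτ.2.le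
    have h1 := h τ ⟨hτ.1.le, hτ.2.le⟩
    have h2 : ∫ s in (0 : ℝ)..τ, (τ - s) • f s
        = τ • (∫ s in (0 : ℝ)..τ, f s) - ∫ s in (0 : ℝ)..τ, s • f s := by
      simp_rw [sub_smul]
      rw [← intervalIntegral.integral_smul]
      exact intervalIntegral.integral_sub ((hf.mono_set hsub).smul τ) (hsf.mono_set hsub)
    rw [h2] at h1
    simp [h1]

/-- The primitive of the indicator function of `(-∞, τ]`. -/
lemma integral_indicator_Iic_const {E : Type*} [NormedAddCommGroup E] [NormedSpace ℝ E]
    [CompleteSpace E] (c : E) {τ t : ℝ} (hτ : 0 ≤ τ) (ht : 0 ≤ t) :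
    ∫ s in (0 : ℝ)..t, (Set.Iic τ).indicator (fun _ => c) s = min t τ • c := by
  rw [intervalIntegral.integral_of_le ht, setIntegral_indicator measurableSet_Iic,
    Set.Ioc_inter_Iic, setIntegral_const]
  simp [ht, hτ]

namespace IsAbstractWeakSolution

variable {V H : Type*} [NormedAddCommGroup V] [InnerProductSpace ℝ V]
  [NormedAddCommGroup H] [InnerProductSpace ℝ H] [CompleteSpace H]
  {e : V →L[ℝ] H} {A : V →L[ℝ] (V →L[ℝ] ℝ)} {T : ℝ} {u₀ : H} {u : ℝ → V}

/-- A weak solution, tested against `(τ - t)⁺ v`. -/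
lemma integral_eq (hu : IsAbstractWeakSolution e A T u₀ u) {τ : ℝ} (hτ : τ ∈ Set.Icc 0 T) (v : V) :
    (∫ t in (0 : ℝ)..τ, ⟪e (u t), e v⟫) + (∫ t in (0 : ℝ)..τ, (τ - t) * A (u t) v)
      = τ * ⟪u₀, e v⟫ := by
  have hφc : Continuous fun t : ℝ => max (τ - t) 0 • v := by fun_prop
  have hsq : IntegrableOn (fun t => ‖(Set.Iic τ).indicator (fun _ => -e v) t‖ ^ 2)
      (Set.Ioc 0 T) := by
    refine Measure.integrableOn_of_bounded (M := ‖e v‖ ^ 2) (by simp) ?_ (.of_forall fun t => ?_)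
    · exact ((stronglyMeasurable_const.indicator measurableSet_Iic).norm.pow 2).aestronglyMeasurable
    · rw [Real.norm_of_nonneg (by positivity)]
      gcongr
      exact (norm_indicator_le_norm_self _ _).trans (norm_neg _).le
  have h := hu.2.2 (fun t => max (τ - t) 0 • v) ((Set.Iic τ).indicator fun _ => -e v)
    hφc.stronglyMeasurable ((hφc.norm.pow 2).integrableOn_Ioc)
    (stronglyMeasurable_const.indicator measurableSet_Iic) hsq
    (fun t ht => by
      rw [integral_indicator_Iic_const _ hτ.1 ht.1, map_smul, map_smul, smul_neg, ← sub_eq_add_neg,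
        ← sub_smul, sub_zero, max_eq_left hτ.1]
      congr 1
      rcases le_total t τ with h | h
      · rw [max_eq_left (by linarith), min_eq_left h]
      · rw [max_eq_right (by linarith), min_eq_right h, sub_self])
    (by simp [hτ.2])
  have hinter : Set.Ioc 0 T ∩ Set.Iic τ = Set.Ioc 0 τ := by
    rw [Set.Ioc_inter_Iic, min_eq_right hτ.2]
  have h1 : ∫ t in Set.Ioc 0 T, ⟪e (u t), (Set.Iic τ).indicator (fun _ => -e v) t⟫
      = -∫ t in (0 : ℝ)..τ, ⟪e (u t), e v⟫ := by
    rw [intervalIntegral.integral_of_le hτ.1, ← hinter, ← setIntegral_indicator measurableSet_Iic,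
      ← integral_neg]
    congr 1 with t
    by_cases ht : t ∈ Set.Iic τ <;> simp [ht]
  have h2 : ∫ t in Set.Ioc 0 T, A (u t) (max (τ - t) 0 • v)
      = ∫ t in (0 : ℝ)..τ, (τ - t) * A (u t) v := by
    rw [intervalIntegral.integral_of_le hτ.1, ← hinter, ← setIntegral_indicator measurableSet_Iic]
    congr 1 with t
    by_cases ht : t ≤ τ
    · simp [ht]
    · simp [ht, (not_le.1 ht).le]
  rw [h1, h2, neg_neg] at h
  simpa [max_eq_left hτ.1, inner_smul_right] using h

lemma intervalIntegrable (hu : IsAbstractWeakSolution e A T u₀ u) (hT : 0 ≤ T) :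
    IntervalIntegrable u volume 0 T := by
  rw [intervalIntegrable_iff_integrableOn_Ioc_of_le hT]
  exact ((memLp_two_iff_integrable_sq_norm hu.1.aestronglyMeasurable).2 hu.2.1).integrable
    (by norm_num)

lemma intervalIntegrable_norm_sq (hu : IsAbstractWeakSolution e A T u₀ u) (hT : 0 ≤ T) :
    IntervalIntegrable (fun t => ‖u t‖ ^ 2) volume 0 T :=
  (intervalIntegrable_iff_integrableOn_Ioc_of_le hT).2 hu.2.1

end IsAbstractWeakSolution

section WeakSolution

variable {V H : Type*} [NormedAddCommGroup V] [InnerProductSpace ℝ V] [CompleteSpace V]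
  [NormedAddCommGroup H] [InnerProductSpace ℝ H] [CompleteSpace H]

/-- The Riesz representative of `A (u t)`. -/
noncomputable def rieszRep (A : V →L[ℝ] (V →L[ℝ] ℝ)) (u : ℝ → V) (t : ℝ) : V :=
  (InnerProductSpace.toDual ℝ V).symm (A (u t))

lemma inner_rieszRep (A : V →L[ℝ] (V →L[ℝ] ℝ)) (u : ℝ → V) (t : ℝ) (v : V) :
    ⟪rieszRep A u t, v⟫ = A (u t) v :=
  InnerProductSpace.toDual_symm_apply

lemma norm_rieszRep_le (A : V →L[ℝ] (V →L[ℝ] ℝ)) (u : ℝ → V) (t : ℝ) :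
    ‖rieszRep A u t‖ ≤ ‖A‖ * ‖u t‖ := by
  rw [rieszRep, LinearIsometryEquiv.norm_map]
  exact A.le_opNorm _

lemma stronglyMeasurable_rieszRep (A : V →L[ℝ] (V →L[ℝ] ℝ)) {u : ℝ → V}
    (hu : StronglyMeasurable u) : StronglyMeasurable (rieszRep A u) :=
  ((InnerProductSpace.toDual ℝ V).symm.continuous.comp A.continuous).comp_stronglyMeasurable hu

namespace IsAbstractWeakSolution

variable {e : V →L[ℝ] H} {A : V →L[ℝ] (V →L[ℝ] ℝ)} {T : ℝ} {u₀ : H} {u : ℝ → V}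

lemma intervalIntegrable_rieszRep (hu : IsAbstractWeakSolution e A T u₀ u) (hT : 0 ≤ T) :
    IntervalIntegrable (rieszRep A u) volume 0 T :=
  ((hu.intervalIntegrable hT).norm.const_mul ‖A‖).mono_fun
    (stronglyMeasurable_rieszRep A hu.1).aestronglyMeasurable
    (.of_forall fun t => (norm_rieszRep_le A u t).trans (le_abs_self _))

/-- The equation in integrated form, pulled back to `V` by the adjoint of `e`. -/
lemma ae_adjoint_eq (hu : IsAbstractWeakSolution e A T u₀ u) (hT : 0 ≤ T) :
    ∀ᵐ t, t ∈ Set.Ioc 0 T →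
      adjoint e (e (u t)) + ∫ s in (0 : ℝ)..t, rieszRep A u s = adjoint e u₀ := by
  have hbint := hu.intervalIntegrable hT
  have hK : IntervalIntegrable (fun t => adjoint e (e (u t))) volume 0 T :=
    ⟨(adjoint e ∘L e).integrable_comp hbint.1, (adjoint e ∘L e).integrable_comp hbint.2⟩
  have hf := hu.intervalIntegrable_rieszRep hT
  refine ae_add_integral_eq_of_integral_eq hT hK hf fun τ hτ => ext_inner_right ℝ fun v => ?_
  have hsub : Set.uIcc 0 τ ⊆ Set.uIcc 0 T := by
    rw [Set.uIcc_of_le hT, Set.uIcc_of_le hτ.1]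
    exact Set.Icc_subset_Icc_right hτ.2
  have hcomm : ∀ {g : ℝ → V}, IntervalIntegrable g volume 0 τ →
      ⟪∫ s in (0 : ℝ)..τ, g s, v⟫ = ∫ s in (0 : ℝ)..τ, ⟪g s, v⟫ := fun {g} hg => by
    simp_rw [real_inner_comm v]
    exact ((innerSL ℝ v).intervalIntegral_comp_comm hg).symm
  rw [inner_add_left, hcomm (hK.mono_set hsub),
    hcomm ((hf.mono_set hsub).continuousOn_smul (by fun_prop))]
  simpa [adjoint_inner_left, real_inner_smul_left, inner_rieszRep] using hu.integral_eq hτ v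

lemma intervalIntegrable_norm_mul_norm_rieszRep (hu : IsAbstractWeakSolution e A T u₀ u)
    (hT : 0 ≤ T) : IntervalIntegrable (fun t => ‖u t‖ * ‖rieszRep A u t‖) volume 0 T :=
  ((hu.intervalIntegrable_norm_sq hT).const_mul ‖A‖).mono_fun
    (hu.1.norm.mul (stronglyMeasurable_rieszRep A hu.1).norm).aestronglyMeasurable
    (.of_forall fun t => by
      refine le_trans ?_ (le_abs_self _)
      simp only [norm_mul, norm_norm]
      nlinarith [norm_rieszRep_le A u t, norm_nonneg (u t)])

/-- The energy identity for a weak solution regularised by a bounded symmetric operator `M`. -/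
lemma norm_sq_regularized_eq (hu : IsAbstractWeakSolution e A T u₀ u) {M : V →L[ℝ] V}
    (hM : ∀ x y, ⟪M x, y⟫ = ⟪x, M y⟫) {t : ℝ} (ht : t ∈ Set.Icc 0 T) :
    ‖e (M (adjoint e u₀ - ∫ s in (0 : ℝ)..t, rieszRep A u s))‖ ^ 2
      = ‖e (M (adjoint e u₀))‖ ^ 2 - 2 * ∫ s in (0 : ℝ)..t,
        ⟪M (adjoint e (e (M (adjoint e (e (u s)))))), rieszRep A u s⟫ := by
  have hT : 0 ≤ T := ht.1.trans ht.2
  have hf : ∀ s ∈ Set.Icc 0 T, IntervalIntegrable (rieszRep A u) volume 0 s := fun s hs =>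
    (hu.intervalIntegrable_rieszRep hT).mono_set <| by
      rw [Set.uIcc_of_le hT, Set.uIcc_of_le hs.1]
      exact Set.Icc_subset_Icc_right hs.2
  have hcomm : ∀ s ∈ Set.Icc 0 T, e (M (adjoint e u₀)) + ∫ r in (0 : ℝ)..s, -e (M (rieszRep A u r))
      = e (M (adjoint e u₀ - ∫ r in (0 : ℝ)..s, rieszRep A u r)) := fun s hs => by
    rw [map_sub, map_sub, intervalIntegral.integral_neg, ← sub_eq_add_neg]
    congr 1
    exact (e ∘L M).intervalIntegral_comp_comm (hf s hs)
  have hg : IntervalIntegrable (fun r => -e (M (rieszRep A u r))) volume 0 t :=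
    IntervalIntegrable.neg ⟨(e ∘L M).integrable_comp (hf t ht).1,
      (e ∘L M).integrable_comp (hf t ht).2⟩
  rw [← hcomm t ht, norm_sq_add_integral_eq hg, sub_eq_add_neg, ← mul_neg,
    ← intervalIntegral.integral_neg]
  congr 2
  refine intervalIntegral.integral_congr_ae ?_
  filter_upwards [hu.ae_adjoint_eq hT] with s hs hst
  rw [Set.uIoc_of_le ht.1] at hst
  rw [hcomm s ⟨hst.1.le, hst.2.trans ht.2⟩, ← hs ⟨hst.1, hst.2.trans ht.2⟩, add_sub_cancel_right,
    inner_neg_right, hM, adjoint_inner_left]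

end IsAbstractWeakSolution

end WeakSolution

/-- Energy equality for weak solutions of the abstract Cauchy problem
`u_t + Au = 0`, `u(0) = u₀`: any weak solution has a continuous `H`-valued
representative `ū` with `ū(0) = u₀` satisfying
`(1/2)‖ū(t)‖² + ∫₀ᵗ (A u)(u) = (1/2)‖u₀‖²` for every `t ∈ [0,T]`. -/
theorem abstract_cauchy_energy_equality
    {V H : Type*} [NormedAddCommGroup V] [InnerProductSpace ℝ V] [CompleteSpace V]
    [TopologicalSpace.SeparableSpace V]
    [NormedAddCommGroup H] [InnerProductSpace ℝ H] [CompleteSpace H]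
    (e : V →L[ℝ] H) (he_inj : Function.Injective e) (he_dense : DenseRange e)
    (A : V →L[ℝ] (V →L[ℝ] ℝ))
    (c : ℝ) (hc : 0 < c)
    (hcoer : ∀ v : V, c * ‖v‖ ^ 2 ≤ A v v + ‖e v‖ ^ 2)
    (T : ℝ) (hT : 0 < T) (u₀ : H) (u : ℝ → V)
    (hu : IsAbstractWeakSolution e A T u₀ u) :
    ∃ ubar : ℝ → H, ContinuousOn ubar (Set.Icc 0 T) ∧
      (∀ᵐ t ∂(volume.restrict (Set.Ioo (0 : ℝ) T)), ubar t = e (u t)) ∧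
      ubar 0 = u₀ ∧
      ∀ t ∈ Set.Icc (0 : ℝ) T,
        (1/2) * ‖ubar t‖ ^ 2 + (∫ s in Set.Ioc (0 : ℝ) t, A (u s) (u s))
          = (1/2) * ‖u₀‖ ^ 2 := by
  have hT0 : 0 ≤ T := hT.le
  obtain ⟨S, hsymm, hcontr, hlimV, hlimH⟩ := exists_approximate_inverse e he_inj he_dense
  set f := rieszRep A u with hfdef
  have hfm : StronglyMeasurable f := stronglyMeasurable_rieszRep A hu.1
  have huf := hu.intervalIntegrable_norm_mul_norm_rieszRep hT0
  set y : ℕ → ℝ → H := fun n t => e (S n (adjoint e u₀ - ∫ s in (0 : ℝ)..t, f s)) with hy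
  have hy0 : Tendsto (fun n => y n 0) atTop (𝓝 u₀) := by simpa [hy] using hlimH u₀
  have hycont : ∀ n, ContinuousOn (y n) (Set.Icc 0 T) := fun n => by
    have := intervalIntegral.continuousOn_primitive_interval'
      (hu.intervalIntegrable_rieszRep hT0) (Set.left_mem_uIcc)
    rw [Set.uIcc_of_le hT0] at this
    exact (e ∘L S n).continuous.comp_continuousOn (continuousOn_const.sub this)
  have hKm : ∀ n, StronglyMeasurable fun s => S n (adjoint e (e (u s))) := fun n =>
    (S n ∘L adjoint e ∘L e).continuous.comp_stronglyMeasurable hu.1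
  have hdiff : ∀ n s, ‖S n (adjoint e (e (u s))) - u s‖ ≤ 2 * ‖u s‖ := fun n s => by
    linarith [norm_sub_le (S n (adjoint e (e (u s)))) (u s), hcontr n (u s)]
  set D : ℕ → ℝ := fun n => ∫ s in (0 : ℝ)..T, ‖S n (adjoint e (e (u s))) - u s‖ * ‖f s‖ with hD
  have hDm : ∀ n, AEStronglyMeasurable
      (fun s => ‖S n (adjoint e (e (u s))) - u s‖ * ‖f s‖) (volume.restrict (Set.uIoc 0 T)) :=
    fun n => (((hKm n).sub hu.1).norm.mul hfm.norm).aestronglyMeasurable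
  have hDle : ∀ n s, ‖‖S n (adjoint e (e (u s))) - u s‖ * ‖f s‖‖ ≤ 2 * (‖u s‖ * ‖f s‖) :=
    fun n s => by
      rw [Real.norm_of_nonneg (by positivity), ← mul_assoc]
      gcongr
      exact hdiff n s
  have hDint : ∀ n, IntervalIntegrable
      (fun s => ‖S n (adjoint e (e (u s))) - u s‖ * ‖f s‖) volume 0 T := fun n =>
    (huf.const_mul 2).mono_fun (hDm n) (.of_forall fun s => (hDle n s).trans (le_abs_self _))
  have hDlim : Tendsto D atTop (𝓝 0) := by
    have := intervalIntegral.tendsto_integral_filter_of_dominated_convergence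
      (fun s => 2 * (‖u s‖ * ‖f s‖)) (.of_forall hDm)
      (.of_forall fun n => .of_forall fun s _ => hDle n s) (huf.const_mul 2)
      (f := fun _ => (0 : ℝ)) (l := atTop) (.of_forall fun s _ => by
        simpa using ((tendsto_iff_norm_sub_tendsto_zero.1 (hlimV (u s))).mul_const ‖f s‖))
    simpa using this
  have hcauchy : ∀ n m, ∀ t ∈ Set.Icc 0 T,
      ‖y n t - y m t‖ ^ 2 ≤ ‖y n 0 - y m 0‖ ^ 2 + 4 * (D n + D m) := fun n m t ht => by
    have hM : ∀ x z, ⟪(S n - S m) x, z⟫ = ⟪x, (S n - S m) z⟫ := fun x z => by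
      simp [inner_sub_left, inner_sub_right, hsymm]
    have hE := hu.norm_sq_regularized_eq hM ht
    have hyM : y n t - y m t = e ((S n - S m) (adjoint e u₀ - ∫ s in (0 : ℝ)..t, f s)) := by
      simp [hy]
    have hyM0 : y n 0 - y m 0 = e ((S n - S m) (adjoint e u₀)) := by simp [hy]
    have hb : ∀ s, ‖⟪(S n - S m) (adjoint e (e ((S n - S m) (adjoint e (e (u s)))))), f s⟫‖
        ≤ 2 * (‖S n (adjoint e (e (u s))) - u s‖ * ‖f s‖
          + ‖S m (adjoint e (e (u s))) - u s‖ * ‖f s‖) := fun s => by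
      set w := (S n - S m) (adjoint e (e (u s))) with hw
      have h1 : ‖w‖ ≤ ‖S n (adjoint e (e (u s))) - u s‖ + ‖S m (adjoint e (e (u s))) - u s‖ := by
        have : w = (S n (adjoint e (e (u s))) - u s) - (S m (adjoint e (e (u s))) - u s) := by
          simp [hw]
        rw [this]
        exact norm_sub_le _ _
      have h2 : ‖(S n - S m) (adjoint e (e w))‖ ≤ 2 * ‖w‖ := by
        rw [sub_apply]
        linarith [norm_sub_le (S n (adjoint e (e w))) (S m (adjoint e (e w))), hcontr n w,
          hcontr m w]
      calc _ ≤ ‖(S n - S m) (adjoint e (e w))‖ * ‖f s‖ := norm_inner_le_norm _ _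
        _ ≤ 2 * (‖S n (adjoint e (e (u s))) - u s‖ + ‖S m (adjoint e (e (u s))) - u s‖) * ‖f s‖ := by
          gcongr
          linarith
        _ = _ := by ring
    have hbint : IntervalIntegrable (fun s => 2 * (‖S n (adjoint e (e (u s))) - u s‖ * ‖f s‖
          + ‖S m (adjoint e (e (u s))) - u s‖ * ‖f s‖)) volume 0 T :=
      ((hDint n).add (hDint m)).const_mul 2
    have hI : |∫ s in (0 : ℝ)..t,
        ⟪(S n - S m) (adjoint e (e ((S n - S m) (adjoint e (e (u s)))))), f s⟫|
        ≤ 2 * (D n + D m) := by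
      rw [hD, ← intervalIntegral.integral_add (hDint n) (hDint m),
        ← intervalIntegral.integral_const_mul, ← Real.norm_eq_abs]
      refine (intervalIntegral.norm_integral_le_of_norm_le ht.1 (.of_forall fun s _ => hb s)
        (hbint.mono_set ?_)).trans (intervalIntegral.integral_mono_interval le_rfl ht.1 ht.2
          (.of_forall fun s => by positivity) hbint)
      rw [Set.uIcc_of_le hT0, Set.uIcc_of_le ht.1]
      exact Set.Icc_subset_Icc_right ht.2
    rw [hyM, hyM0, hE]
    linarith [neg_abs_le (∫ s in (0 : ℝ)..t,
        ⟪(S n - S m) (adjoint e (e ((S n - S m) (adjoint e (e (u s)))))), f s⟫)]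
  have hunif : UniformCauchySeqOn y atTop (Set.Icc 0 T) := by
    rw [Metric.uniformCauchySeqOn_iff]
    intro ε hε
    obtain ⟨N, hN⟩ := eventually_atTop.1
      ((Metric.tendsto_nhds.1 hy0 (ε / 4) (by positivity)).and
        (hDlim.eventually (gt_mem_nhds (show 0 < ε ^ 2 / 32 by positivity))))
    refine ⟨N, fun m hm n hn t ht => ?_⟩
    have h1 : ‖y m 0 - y n 0‖ < ε / 2 := by
      rw [← dist_eq_norm]
      linarith [dist_triangle_right (y m 0) (y n 0) u₀, (hN m hm).1, (hN n hn).1]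
    have h2 := hcauchy m n t ht
    rw [dist_eq_norm]
    refine lt_of_pow_lt_pow_left₀ 2 hε.le ?_
    nlinarith [(hN m hm).2, (hN n hn).2, norm_nonneg (y m 0 - y n 0)]
  set ubar : ℝ → H := fun t => limUnder atTop fun n => y n t with hubar
  have hlim : ∀ t ∈ Set.Icc 0 T, Tendsto (fun n => y n t) atTop (𝓝 (ubar t)) :=
    fun t ht => (hunif.cauchySeq ht).tendsto_limUnder
  have hubar0 : ubar 0 = u₀ := tendsto_nhds_unique (hlim 0 ⟨le_rfl, hT0⟩) hy0
  refine ⟨ubar, (hunif.tendstoUniformlyOn_of_tendsto hlim).continuousOn (.of_forall hycont), ?_,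
    hubar0, fun t ht => ?_⟩
  · rw [ae_restrict_iff' measurableSet_Ioo]
    filter_upwards [hu.ae_adjoint_eq hT0] with t ht hmem
    refine tendsto_nhds_unique (hlim t (Set.Ioo_subset_Icc_self hmem)) ?_
    simp only [hy, ← ht (Set.Ioo_subset_Ioc_self hmem), hfdef, add_sub_cancel_right]
    exact (e.continuous.tendsto _).comp (hlimV (u t))
  · have hsub : Set.uIcc 0 t ⊆ Set.uIcc 0 T := by
      rw [Set.uIcc_of_le hT0, Set.uIcc_of_le ht.1]
      exact Set.Icc_subset_Icc_right ht.2
    have hIlim : Tendsto (fun n => ∫ s in (0 : ℝ)..t,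
        ⟪S n (adjoint e (e (S n (adjoint e (e (u s)))))), f s⟫) atTop
        (𝓝 (∫ s in (0 : ℝ)..t, A (u s) (u s))) := by
      refine intervalIntegral.tendsto_integral_filter_of_dominated_convergence
        (fun s => ‖u s‖ * ‖f s‖) (.of_forall fun n => ?_)
        (.of_forall fun n => .of_forall fun s _ => ?_) (huf.mono_set hsub)
        (.of_forall fun s _ => ?_)
      · exact (((S n ∘L adjoint e ∘L e).continuous.comp_stronglyMeasurable (hKm n)).inner
          hfm).aestronglyMeasurable
      · refine (norm_inner_le_norm _ _).trans ?_
        gcongr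
        exact (hcontr n _).trans (hcontr n _)
      · rw [← inner_rieszRep, real_inner_comm]
        refine Tendsto.inner ?_ tendsto_const_nhds
        rw [tendsto_iff_norm_sub_tendsto_zero]
        have h2 := (tendsto_iff_norm_sub_tendsto_zero.1 (hlimV (u s))).const_mul 2
        rw [mul_zero] at h2
        refine squeeze_zero (fun _ => norm_nonneg _) (fun n => ?_) h2
        set w := S n (adjoint e (e (u s)))
        have h3 := hcontr n (w - u s)
        simp only [map_sub] at h3
        linarith [norm_sub_le_norm_sub_add_norm_sub (S n (adjoint e (e w))) w (u s)]
    have h1 := ((hlim t ht).norm.pow 2)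
    have h2 := (((hlim 0 ⟨le_rfl, hT0⟩).norm.pow 2)).sub (hIlim.const_mul 2)
    have h3 := tendsto_nhds_unique h1 (h2.congr fun n => ?_)
    · rw [← intervalIntegral.integral_of_le ht.1, h3, hubar0]
      ring
    · rw [show y n t = e (S n (adjoint e u₀ - ∫ s in (0 : ℝ)..t, f s)) from rfl,
        hu.norm_sq_regularized_eq (hsymm n) ht]
      simp [hy, hfdef]
end

section
/- Let N ≥ 2 and let Ω = 𝕋^{N−1} × (0,1), where 𝕋^{N−1} = ℝ^{N−1}/ℤ^{N−1} is the flat torus with its Haar (Lebesgue) measure; write x = (x′, x_N). Fix ε ∈ (0,1/2) and set a_ε(x) = min(x_N/ε, (1−x_N)/ε, 1) and s(x_N) = 1/ε for x_N ∈ (0,ε), 0 for x_N ∈ (ε,1−ε), −1/ε for x_N ∈ (1−ε,1). Let u : Ω → ℝ be smooth (C^∞) on the open cylinder with ∫_Ω u² dx < ∞, ∫_Ω a_ε |∇u|² dx < ∞ and ∫_Ω ( a_ε Δu + s(x_N) ∂u/∂x_N )² dx < ∞. Then for every continuously differentiable ψ : 𝕋^{N−1} → ℝ, lim_{δ→0⁺}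 ∫_{𝕋^{N−1}} a_ε(x′, δ) (∂u/∂x_N)(x′, δ) ψ(x′) dx′ = 0, and likewise lim_{δ→0⁺} ∫_{𝕋^{N−1}} a_ε(x′, 1−δ) (∂u/∂x_N)(x′, 1−δ) ψ(x′) dx′ = 0. -/
open MeasureTheory
open scoped ENNReal
noncomputable section

/-- Fundamental domain `[0,1)^n` of the flat torus `𝕋^n = ℝ^n/ℤ^n`. -/
def unitBox (n : ℕ) : Set (Fin n → ℝ) := Set.univ.pi fun _ => Set.Ico (0:ℝ) 1

/-- The flat cylinder `Ω = 𝕋^n × (0,1)`, realized as the fundamental domain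
`[0,1)^n × (0,1)` inside `ℝ^n × ℝ`. -/
def cyl (n : ℕ) : Set ((Fin n → ℝ) × ℝ) := (unitBox n) ×ˢ Set.Ioo (0:ℝ) 1

/-- The `i`-th coordinate direction in `ℝ^n × ℝ`. -/
def dirVec (n : ℕ) (i : Fin (n + 1)) : (Fin n → ℝ) × ℝ :=
  Fin.lastCases ((0 : Fin n → ℝ), (1 : ℝ)) (fun j => (Pi.single j (1:ℝ), (0:ℝ))) i

/-- Second directional derivative `∂²u/∂v∂w` at `p`. -/
def pd2 {n : ℕ} (u : (Fin n → ℝ) × ℝ → ℝ) (v w : (Fin n → ℝ) × ℝ)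
    (p : (Fin n → ℝ) × ℝ) : ℝ :=
  fderiv ℝ (fun q => fderiv ℝ u q v) p w

/-- The degenerate weight `a_ε(t) = min(t/ε, (1−t)/ε, 1)`. -/
def aWt (ε t : ℝ) : ℝ := min (t / ε) (min ((1 - t) / ε) 1)

/-- The a.e. derivative `s` of `a_ε` in the vertical direction. -/
def sWt (ε t : ℝ) : ℝ := if t < ε then 1/ε else if t ≤ 1 - ε then 0 else -(1/ε)

theorem tendsto_zero_of_hasDerivAt_of_sq_le {F H K : ℝ → ℝ} {b : ℝ} (hb : 0 < b)
    (hF : ∀ t ∈ Set.Ioo 0 b, HasDerivAt F (H t) t)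
    (hH : IntegrableOn H (Set.Ioo 0 b)) (hK : IntegrableOn K (Set.Ioo 0 b))
    (hFK : ∀ t ∈ Set.Ioo 0 b, F t ^ 2 ≤ t * K t) :
    Filter.Tendsto F (nhdsWithin 0 (Set.Ioi 0)) (nhds 0) := by
  have hb2 : 0 < b / 2 := by linarith
  have hII : IntervalIntegrable H volume 0 (b / 2) := by
    rw [intervalIntegrable_iff_integrableOn_Ioo_of_le hb2.le]
    exact hH.mono_set (Set.Ioo_subset_Ioo_right (by linarith))
  have hcont : ContinuousOn (fun t => ∫ x in (b / 2)..t, H x) (Set.uIcc 0 (b / 2)) :=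
    intervalIntegral.continuousOn_primitive_interval' hII Set.right_mem_uIcc
  have hFeq : ∀ t ∈ Set.Ioo 0 (b / 2), F (b / 2) + ∫ x in (b / 2)..t, H x = F t := by
    intro t ht
    rw [intervalIntegral.integral_eq_sub_of_hasDerivAt (f := F) (f' := H)]
    · ring
    · intro x hx
      rw [Set.uIcc_of_ge ht.2.le] at hx
      exact hF x ⟨ht.1.trans_le hx.1, hx.2.trans_lt (by linarith)⟩
    · refine hII.mono_set ?_
      rw [Set.uIcc_of_ge ht.2.le, Set.uIcc_of_le hb2.le]
      exact Set.Icc_subset_Icc_left ht.1.le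
  obtain ⟨L, hL⟩ : ∃ L, Filter.Tendsto F (nhdsWithin 0 (Set.Ioi 0)) (nhds L) := by
    refine ⟨_, Filter.Tendsto.congr' ?_ (((hcont 0 Set.left_mem_uIcc).mono_left ?_).const_add
      (F (b / 2)))⟩
    · filter_upwards [Ioo_mem_nhdsGT hb2] with t ht using hFeq t ht
    · rw [← nhdsWithin_Ioo_eq_nhdsGT hb2, Set.uIcc_of_le hb2.le]
      exact nhdsWithin_mono _ Set.Ioo_subset_Icc_self
  by_cases hL0 : L = 0
  · rwa [hL0] at hL
  exfalso
  have hLpos : 0 < L ^ 2 := by positivity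
  have hev : ∀ᶠ t in nhdsWithin 0 (Set.Ioi 0), L ^ 2 / 2 < F t ^ 2 :=
    (hL.pow 2).eventually_const_lt (by linarith)
  obtain ⟨c, hc, hcF⟩ := (mem_nhdsGT_iff_exists_Ioo_subset).1 hev
  have hc : 0 < c := hc
  set d := min b c with hd
  have hd0 : 0 < d := lt_min hb hc
  have hinv : IntervalIntegrable (fun x : ℝ => x⁻¹) volume 0 d := by
    rw [intervalIntegrable_iff_integrableOn_Ioo_of_le hd0.le]
    refine Integrable.mono' (g := fun t => (2 / L ^ 2) * K t)
      ((hK.mono_set (Set.Ioo_subset_Ioo_right (min_le_left _ _))).const_mul _)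
      measurable_inv.aestronglyMeasurable ?_
    filter_upwards [self_mem_ae_restrict measurableSet_Ioo] with t ht
    have h1 := hFK t ⟨ht.1, ht.2.trans_le (min_le_left _ _)⟩
    have h2 : L ^ 2 / 2 < F t ^ 2 := hcF ⟨ht.1, ht.2.trans_le (min_le_right _ _)⟩
    have ht0 : 0 < t := ht.1
    rw [Real.norm_of_nonneg (by positivity), inv_eq_one_div, div_mul_eq_mul_div,
      div_le_div_iff₀ ht0 hLpos]
    nlinarith
  rw [intervalIntegrable_inv_iff] at hinv
  rcases hinv with h | h
  · exact hd0.ne h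
  · exact h Set.left_mem_uIcc

theorem measurableSet_unitBox (n : ℕ) : MeasurableSet (unitBox n) :=
  MeasurableSet.univ_pi fun _ => measurableSet_Ico

theorem unitBox_subset_Icc (n : ℕ) : unitBox n ⊆ Set.Icc 0 1 := fun _ hx =>
  ⟨fun i => (hx i trivial).1, fun i => (hx i trivial).2.le⟩

theorem unitBox_ae_eq_Icc (n : ℕ) : unitBox n =ᵐ[volume] Set.Icc (0 : Fin n → ℝ) 1 :=
  Measure.univ_pi_Ico_ae_eq_Icc

instance isProbabilityMeasure_restrict_unitBox (n : ℕ) :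
    IsProbabilityMeasure ((volume : Measure (Fin n → ℝ)).restrict (unitBox n)) :=
  ⟨by simp [unitBox, Real.volume_pi_Ico]⟩

theorem Continuous.integrableOn_unitBox {n : ℕ} {f : (Fin n → ℝ) → ℝ} (hf : Continuous f) :
    IntegrableOn f (unitBox n) :=
  (hf.continuousOn.integrableOn_compact isCompact_Icc).mono_set (unitBox_subset_Icc n)

/-- The integral over the torus of a partial derivative vanishes. -/
theorem integral_unitBox_fderiv_single_eq_zero {n : ℕ} {w : (Fin n → ℝ) → ℝ}
    (hw : ContDiff ℝ 1 w) (i : Fin n) (hper : ∀ x, w (x + Pi.single i 1) = w x) :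
    ∫ x in unitBox n, fderiv ℝ w x (Pi.single i 1) = 0 := by
  obtain ⟨m, rfl⟩ : ∃ m, n = m + 1 := ⟨n - 1, by have := i.pos; omega⟩
  have hsum : ∀ x, ∑ j, (if j = i then fderiv ℝ w x else 0) (Pi.single j (1 : ℝ))
      = fderiv ℝ w x (Pi.single i 1) := by
    intro x
    rw [Finset.sum_eq_single i]
    · simp
    · intro j _ hj; simp [hj]
    · simp
  have hcd : Continuous fun x => fderiv ℝ w x (Pi.single i (1 : ℝ)) :=
    (hw.continuous_fderiv one_ne_zero).clm_apply continuous_const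
  have key := integral_divergence_of_hasFDerivAt_off_countable' (0 : Fin (m + 1) → ℝ) 1
    (fun _ => zero_le_one) (fun j x => if j = i then w x else 0)
    (fun j x => if j = i then fderiv ℝ w x else 0) ∅ Set.countable_empty
    (fun j => by
      by_cases h : j = i
      · simpa [h] using hw.continuous.continuousOn
      · simpa [h] using continuousOn_const)
    (fun x _ j => by
      by_cases h : j = i
      · simpa [h] using (hw.differentiable one_ne_zero x).hasFDerivAt
      · simpa [h] using hasFDerivAt_const (0 : ℝ) x)
    (by
      simp only [hsum]
      exact hcd.continuousOn.integrableOn_compact isCompact_Icc)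
  simp only [hsum] at key
  rw [setIntegral_congr_set (unitBox_ae_eq_Icc _), key]
  refine Finset.sum_eq_zero fun j _ => ?_
  by_cases h : j = i
  · subst h
    rw [sub_eq_zero]
    refine integral_congr_ae (Filter.Eventually.of_forall fun x => ?_)
    simp only [if_true]
    refine Eq.trans (congrArg w ?_) (hper (j.insertNth 0 x))
    ext k
    refine Fin.succAboveCases j ?_ (fun k => ?_) k <;> simp
  · simp [h]

theorem sq_integral_le_integral_sq {α : Type*} [MeasurableSpace α] {μ : Measure α}
    [IsProbabilityMeasure μ] {f : α → ℝ} (hf : Integrable f μ)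
    (hf2 : Integrable (fun x => f x ^ 2) μ) : (∫ x, f x ∂μ) ^ 2 ≤ ∫ x, f x ^ 2 ∂μ := by
  set c := ∫ x, f x ∂μ with hc
  have h0 : 0 ≤ ∫ x, (f x - c) ^ 2 ∂μ := integral_nonneg fun x => sq_nonneg _
  have h1 : ∫ x, (f x - c) ^ 2 ∂μ = ∫ x, (f x ^ 2 - 2 * c * f x) + c ^ 2 ∂μ := by
    congr 1; ext x; ring
  have h2 : Integrable (fun x => f x ^ 2 - 2 * c * f x) μ := hf2.sub (hf.const_mul _)
  rw [h1, integral_add h2 (integrable_const _), integral_sub hf2 (hf.const_mul _),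
    integral_const_mul, ← hc, integral_const, probReal_univ, one_smul] at h0
  nlinarith

/-- The open slab `ℝ^n × (0,1)`. -/
def slab (n : ℕ) : Set ((Fin n → ℝ) × ℝ) := {p | p.2 ∈ Set.Ioo (0 : ℝ) 1}

theorem isOpen_slab (n : ℕ) : IsOpen (slab n) := isOpen_Ioo.preimage continuous_snd

theorem ContinuousOn.continuous_slab_slice {n : ℕ} {f : (Fin n → ℝ) × ℝ → ℝ}
    (hf : ContinuousOn f (slab n)) {t : ℝ} (ht : t ∈ Set.Ioo (0 : ℝ) 1) :
    Continuous fun x => f (x, t) :=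
  hf.comp_continuous (by fun_prop) fun _ => ht

theorem ContDiffOn.contDiff_slab_slice {n : ℕ} {f : (Fin n → ℝ) × ℝ → ℝ}
    (hf : ContDiffOn ℝ 1 f (slab n)) {t : ℝ} (ht : t ∈ Set.Ioo (0 : ℝ) 1) :
    ContDiff ℝ 1 fun x => f (x, t) :=
  hf.comp_contDiff (g := f) (f := fun x : Fin n → ℝ => (x, t)) (by fun_prop) fun _ => ht

theorem ContDiffOn.fderiv_slab_apply {n : ℕ} {f : (Fin n → ℝ) × ℝ → ℝ}
    (hf : ContDiffOn ℝ (⊤ : ℕ∞) f (slab n)) (v : (Fin n → ℝ) × ℝ) :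
    ContDiffOn ℝ (⊤ : ℕ∞) (fun q => fderiv ℝ f q v) (slab n) :=
  (hf.fderiv_of_isOpen (isOpen_slab n) (by simp)).clm_apply contDiffOn_const

theorem hasDerivAt_integral_slab_slice {n : ℕ} {v : (Fin n → ℝ) × ℝ → ℝ}
    (hv : ContDiffOn ℝ (⊤ : ℕ∞) v (slab n)) {ψ : (Fin n → ℝ) → ℝ} (hψ : Continuous ψ)
    {t : ℝ} (ht : t ∈ Set.Ioo (0 : ℝ) 1) :
    HasDerivAt (fun t => ∫ x in unitBox n, v (x, t) * ψ x)
      (∫ x in unitBox n, fderiv ℝ v (x, t) (0, 1) * ψ x) t := by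
  have hd : ContinuousOn (fun q => fderiv ℝ v q (0, 1)) (slab n) :=
    (hv.fderiv_slab_apply _).continuousOn
  obtain ⟨r, hr, hrs⟩ := Metric.nhds_basis_closedBall.mem_iff.1 (Ioo_mem_nhds ht.1 ht.2)
  have hcomp : IsCompact (Set.Icc (0 : Fin n → ℝ) 1 ×ˢ Metric.closedBall t r) :=
    isCompact_Icc.prod (isCompact_closedBall _ _)
  have hcont : ContinuousOn (fun q : (Fin n → ℝ) × ℝ => fderiv ℝ v q (0, 1) * ψ q.1)
      (Set.Icc (0 : Fin n → ℝ) 1 ×ˢ Metric.closedBall t r) :=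
    (hd.mono fun q hq => hrs hq.2).mul (hψ.comp continuous_fst).continuousOn
  obtain ⟨C, hC⟩ := hcomp.exists_bound_of_continuousOn hcont
  refine (hasDerivAt_integral_of_dominated_loc_of_deriv_le (bound := fun _ => C)
    (F := fun t x => v (x, t) * ψ x) (F' := fun t x => fderiv ℝ v (x, t) (0, 1) * ψ x)
    (Metric.closedBall_mem_nhds t hr) ?_ ?_ ?_ ?_ (integrable_const _) ?_).2
  · filter_upwards [Metric.closedBall_mem_nhds t hr] with s hs
    exact ((hv.continuousOn.continuous_slab_slice (hrs hs)).mul hψ).aestronglyMeasurable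
  · exact ((hv.continuousOn.continuous_slab_slice ht).mul hψ).integrableOn_unitBox
  · exact ((hd.continuous_slab_slice ht).mul hψ).aestronglyMeasurable
  · filter_upwards [self_mem_ae_restrict (measurableSet_unitBox n)] with x hx s hs
    exact hC (x, s) ⟨unitBox_subset_Icc n hx, hs⟩
  · refine Filter.Eventually.of_forall fun x s hs => HasDerivAt.mul_const ?_ _
    have h1 : HasFDerivAt v (fderiv ℝ v (x, s)) (x, s) :=
      ((hv.differentiableOn (by simp)).differentiableAt
        ((isOpen_slab n).mem_nhds (hrs hs))).hasFDerivAt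
    exact h1.comp_hasDerivAt s ((hasDerivAt_const s x).prodMk (hasDerivAt_id s))

theorem aWt_nonneg {ε t : ℝ} (hε : 0 < ε) (ht : t ∈ Set.Ioo (0 : ℝ) 1) : 0 ≤ aWt ε t :=
  le_min (div_nonneg ht.1.le hε.le) (le_min (div_nonneg (by linarith [ht.2]) hε.le) zero_le_one)

theorem aWt_le_one (ε t : ℝ) : aWt ε t ≤ 1 := (min_le_right _ _).trans (min_le_right _ _)

theorem continuous_aWt (ε : ℝ) : Continuous (aWt ε) := by
  unfold aWt; fun_prop

theorem measurable_sWt (ε : ℝ) : Measurable (sWt ε) :=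
  Measurable.ite measurableSet_Iio measurable_const
    (Measurable.ite measurableSet_Iic measurable_const measurable_const)

theorem hasDerivAt_aWt {ε t : ℝ} (hε : ε ∈ Set.Ioo (0 : ℝ) (1 / 2))
    (ht : t ∈ Set.Ioo 0 ε ∪ Set.Ioo (1 - ε) 1) : HasDerivAt (aWt ε) (sWt ε t) t := by
  obtain ⟨hε0, hε1⟩ := hε
  rcases ht with ht | ht
  · have hs : sWt ε t = 1 / ε := if_pos ht.2
    rw [hs]
    refine ((hasDerivAt_id t).div_const ε).congr_of_eventuallyEq ?_
    filter_upwards [Ioo_mem_nhds ht.1 ht.2] with x hx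
    have hx2 := hx.2
    refine min_eq_left (le_min ?_ ?_)
    · gcongr; linarith
    · exact (div_le_one hε0).2 hx2.le
  · have hs : sWt ε t = -1 / ε := by
      rw [sWt, if_neg (by linarith [ht.1]), if_neg (by linarith [ht.1])]; ring
    rw [hs]
    refine (((hasDerivAt_id t).const_sub 1).div_const ε).congr_of_eventuallyEq ?_
    filter_upwards [Ioo_mem_nhds ht.1 ht.2] with x hx
    have hx1 := hx.1
    have h1 : (1 - x) / ε ≤ 1 := by rw [div_le_one hε0]; linarith
    rw [aWt, min_eq_left h1, min_eq_right]
    · rfl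
    · gcongr; linarith

theorem measurableSet_cyl (n : ℕ) : MeasurableSet (cyl n) :=
  (measurableSet_unitBox n).prod measurableSet_Ioo

theorem cyl_subset_slab (n : ℕ) : cyl n ⊆ slab n := fun _ hp => hp.2

theorem volume_restrict_cyl (n : ℕ) :
    (volume : Measure ((Fin n → ℝ) × ℝ)).restrict (cyl n) =
      (volume.restrict (unitBox n)).prod (volume.restrict (Set.Ioo (0 : ℝ) 1)) := by
  rw [Measure.prod_restrict]; rfl

instance isFiniteMeasure_restrict_cyl (n : ℕ) :
    IsFiniteMeasure ((volume : Measure ((Fin n → ℝ) × ℝ)).restrict (cyl n)) := by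
  rw [volume_restrict_cyl]
  infer_instance

theorem ContinuousOn.aestronglyMeasurable_cyl {n : ℕ} {f : (Fin n → ℝ) × ℝ → ℝ}
    (hf : ContinuousOn f (slab n)) : AEStronglyMeasurable f (volume.restrict (cyl n)) :=
  (hf.mono (cyl_subset_slab n)).aestronglyMeasurable (measurableSet_cyl n)

theorem integrableOn_slice_integral {n : ℕ} {f : (Fin n → ℝ) × ℝ → ℝ}
    (hf : IntegrableOn f (cyl n)) :
    IntegrableOn (fun t => ∫ x in unitBox n, f (x, t)) (Set.Ioo (0 : ℝ) 1) := by
  rw [IntegrableOn, volume_restrict_cyl] at hf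
  exact hf.integral_prod_right

@[simp] theorem dirVec_castSucc {n : ℕ} (j : Fin n) :
    dirVec n j.castSucc = (Pi.single j 1, 0) := by simp [dirVec]

@[simp] theorem dirVec_last (n : ℕ) : dirVec n (Fin.last n) = (0, 1) := by simp [dirVec]

/-- The weighted divergence `div (a_ε ∇u)`. -/
def weightedDiv {n : ℕ} (ε : ℝ) (u : (Fin n → ℝ) × ℝ → ℝ) (p : (Fin n → ℝ) × ℝ) : ℝ :=
  aWt ε p.2 * (∑ i : Fin (n + 1), pd2 u (dirVec n i) (dirVec n i) p)
    + sWt ε p.2 * fderiv ℝ u p (0, 1)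

/-- The weighted energy density `a_ε |∇u|²`. -/
def energyDensity {n : ℕ} (ε : ℝ) (u : (Fin n → ℝ) × ℝ → ℝ) (p : (Fin n → ℝ) × ℝ) : ℝ :=
  aWt ε p.2 * ∑ i : Fin (n + 1), (fderiv ℝ u p (dirVec n i)) ^ 2

/-- The density `div (a_ε ∇u) ψ + a_ε ∇u · ∇ψ` (the second gradients taken in the torus directions
only), whose slice integrals are the derivative of the tested flux. -/
def fluxDensity {n : ℕ} (ε : ℝ) (u : (Fin n → ℝ) × ℝ → ℝ) (ψ : (Fin n → ℝ) → ℝ)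
    (p : (Fin n → ℝ) × ℝ) : ℝ :=
  weightedDiv ε u p * ψ p.1 + aWt ε p.2 *
    ∑ j : Fin n, fderiv ℝ u p (Pi.single j 1, 0) * fderiv ℝ ψ p.1 (Pi.single j 1)

theorem continuousOn_fderiv_slab {n : ℕ} {u : (Fin n → ℝ) × ℝ → ℝ}
    (hu : ContDiffOn ℝ (⊤ : ℕ∞) u (slab n)) (v : (Fin n → ℝ) × ℝ) :
    ContinuousOn (fun p => fderiv ℝ u p v) (slab n) := (hu.fderiv_slab_apply v).continuousOn

theorem continuousOn_pd2_slab {n : ℕ} {u : (Fin n → ℝ) × ℝ → ℝ}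
    (hu : ContDiffOn ℝ (⊤ : ℕ∞) u (slab n)) (v w : (Fin n → ℝ) × ℝ) :
    ContinuousOn (pd2 u v w) (slab n) :=
  ((hu.fderiv_slab_apply v).fderiv_slab_apply w).continuousOn

theorem integrableOn_of_lintegral_ofReal_lt_top {α : Type*} [MeasurableSpace α] {μ : Measure α}
    {s : Set α} (hs : MeasurableSet s) {f : α → ℝ} (hf : AEStronglyMeasurable f (μ.restrict s))
    (h0 : ∀ x ∈ s, 0 ≤ f x) (h : ∫⁻ x in s, ENNReal.ofReal (f x) ∂μ < ⊤) : IntegrableOn f s μ :=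
  (lintegral_ofReal_ne_top_iff_integrable hf
    ((ae_restrict_iff' hs).2 (Filter.Eventually.of_forall h0))).1 h.ne

theorem energyDensity_nonneg {n : ℕ} {ε : ℝ} (hε : 0 < ε) (u : (Fin n → ℝ) × ℝ → ℝ)
    {p : (Fin n → ℝ) × ℝ} (hp : p ∈ slab n) : 0 ≤ energyDensity ε u p :=
  mul_nonneg (aWt_nonneg hε hp) (Finset.sum_nonneg fun _ _ => sq_nonneg _)

theorem continuousOn_energyDensity {n : ℕ} (ε : ℝ) {u : (Fin n → ℝ) × ℝ → ℝ}
    (hu : ContDiffOn ℝ (⊤ : ℕ∞) u (slab n)) : ContinuousOn (energyDensity ε u) (slab n) :=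
  ((continuous_aWt ε).comp continuous_snd).continuousOn.mul
    (continuousOn_finsetSum _ fun _ _ => (continuousOn_fderiv_slab hu _).pow 2)

theorem aestronglyMeasurable_weightedDiv {n : ℕ} (ε : ℝ) {u : (Fin n → ℝ) × ℝ → ℝ}
    (hu : ContDiffOn ℝ (⊤ : ℕ∞) u (slab n)) :
    AEStronglyMeasurable (weightedDiv ε u) (volume.restrict (cyl n)) := by
  refine AEStronglyMeasurable.add (ContinuousOn.aestronglyMeasurable_cyl ?_)
    (AEStronglyMeasurable.mul ?_ (continuousOn_fderiv_slab hu _).aestronglyMeasurable_cyl)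
  · exact ((continuous_aWt ε).comp continuous_snd).continuousOn.mul
      (continuousOn_finsetSum _ fun _ _ => continuousOn_pd2_slab hu _ _)
  · exact ((measurable_sWt ε).comp measurable_snd).aestronglyMeasurable

theorem integrableOn_fluxDensity {n : ℕ} {ε : ℝ} (hε : 0 < ε) {u : (Fin n → ℝ) × ℝ → ℝ}
    (hu : ContDiffOn ℝ (⊤ : ℕ∞) u (slab n))
    (hE : IntegrableOn (energyDensity ε u) (cyl n))
    (hD : IntegrableOn (fun p => weightedDiv ε u p ^ 2) (cyl n))
    {ψ : (Fin n → ℝ) → ℝ} (hψ : ContDiff ℝ 1 ψ) :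
    IntegrableOn (fluxDensity ε u ψ) (cyl n) := by
  have hdψ : ∀ j : Fin n, Continuous fun x => fderiv ℝ ψ x (Pi.single j 1) := fun j =>
    (hψ.continuous_fderiv one_ne_zero).clm_apply continuous_const
  have hB : Continuous fun x => ψ x ^ 2 + ∑ j, fderiv ℝ ψ x (Pi.single j 1) ^ 2 :=
    (hψ.continuous.pow 2).add (continuous_finsetSum _ fun j _ => (hdψ j).pow 2)
  obtain ⟨C, hC⟩ := (isCompact_Icc (a := (0 : Fin n → ℝ)) (b := 1)).exists_bound_of_continuousOn
    hB.continuousOn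
  have hg : IntegrableOn (fun p => weightedDiv ε u p ^ 2 + energyDensity ε u p + C) (cyl n) :=
    (hD.add hE).add (integrable_const C)
  refine Integrable.mono' hg ?_ ?_
  · refine AEStronglyMeasurable.add ((aestronglyMeasurable_weightedDiv ε hu).mul
      (hψ.continuous.comp continuous_fst).aestronglyMeasurable)
      (ContinuousOn.aestronglyMeasurable_cyl ?_)
    exact ((continuous_aWt ε).comp continuous_snd).continuousOn.mul
      (continuousOn_finsetSum _ fun j _ => (continuousOn_fderiv_slab hu _).mul
        ((hdψ j).comp continuous_fst).continuousOn)
  · filter_upwards [self_mem_ae_restrict (measurableSet_cyl n)] with p hp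
    have ha0 := aWt_nonneg hε hp.2
    have ha1 := aWt_le_one ε p.2
    have hCp := (le_abs_self _).trans (hC p.1 (unitBox_subset_Icc n hp.1))
    have h1 : |weightedDiv ε u p * ψ p.1| ≤ weightedDiv ε u p ^ 2 + ψ p.1 ^ 2 := by
      rw [abs_le]; constructor <;> nlinarith [sq_nonneg (weightedDiv ε u p + ψ p.1),
        sq_nonneg (weightedDiv ε u p - ψ p.1)]
    have h2 : |∑ j : Fin n, fderiv ℝ u p (Pi.single j 1, 0) * fderiv ℝ ψ p.1 (Pi.single j 1)|
        ≤ ∑ j : Fin n, fderiv ℝ u p (Pi.single j 1, 0) ^ 2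
          + ∑ j, fderiv ℝ ψ p.1 (Pi.single j 1) ^ 2 := by
      rw [← Finset.sum_add_distrib]
      refine (Finset.abs_sum_le_sum_abs _ _).trans (Finset.sum_le_sum fun j _ => ?_)
      generalize fderiv ℝ u p (Pi.single j 1, 0) = a
      generalize fderiv ℝ ψ p.1 (Pi.single j 1) = b
      rw [abs_le]; constructor <;> nlinarith [sq_nonneg (a + b), sq_nonneg (a - b)]
    have h3 : energyDensity ε u p = aWt ε p.2 * ∑ j : Fin n, fderiv ℝ u p (Pi.single j 1, 0) ^ 2
        + aWt ε p.2 * fderiv ℝ u p (0, 1) ^ 2 := by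
      simp [energyDensity, Fin.sum_univ_castSucc, mul_add]
    have h4 : 0 ≤ aWt ε p.2 * fderiv ℝ u p (0, 1) ^ 2 := mul_nonneg ha0 (sq_nonneg _)
    have h5 : 0 ≤ ∑ j, fderiv ℝ ψ p.1 (Pi.single j 1) ^ 2 :=
      Finset.sum_nonneg fun _ _ => sq_nonneg _
    rw [Real.norm_eq_abs, fluxDensity]
    refine (abs_add_le _ _).trans ?_
    rw [abs_mul (aWt ε p.2), abs_of_nonneg ha0]
    have h6 := mul_le_mul_of_nonneg_left h2 ha0
    have h7 := mul_le_mul_of_nonneg_right ha1 h5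
    linarith

theorem fderiv_add_single_of_periodic {n : ℕ} {u : (Fin n → ℝ) × ℝ → ℝ}
    (hper : ∀ (p : (Fin n → ℝ) × ℝ) (i : Fin n), u (p.1 + Pi.single i 1, p.2) = u p)
    (x : Fin n → ℝ) (t : ℝ) (i : Fin n) :
    fderiv ℝ u (x + Pi.single i 1, t) = fderiv ℝ u (x, t) := by
  have h : (fun p => u (p + (Pi.single i 1, 0))) = u := by
    ext p
    rw [← hper p i]
    congr 1
    ext <;> simp
  have h2 := fderiv_comp_add_right (𝕜 := ℝ) (f := u) (x := (x, t)) (Pi.single i 1, 0)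
  rw [h] at h2
  simpa using h2.symm

/-- Integration by parts in a torus direction. -/
theorem integral_slice_by_parts {n : ℕ} {u : (Fin n → ℝ) × ℝ → ℝ}
    (hu : ContDiffOn ℝ (⊤ : ℕ∞) u (slab n))
    (hper : ∀ (p : (Fin n → ℝ) × ℝ) (i : Fin n), u (p.1 + Pi.single i 1, p.2) = u p)
    {ψ : (Fin n → ℝ) → ℝ} (hψ : ContDiff ℝ 1 ψ)
    (hψper : ∀ (x : Fin n → ℝ) (i : Fin n), ψ (x + Pi.single i 1) = ψ x)
    {t : ℝ} (ht : t ∈ Set.Ioo (0 : ℝ) 1) (j : Fin n) :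
    ∫ x in unitBox n, (pd2 u (Pi.single j 1, 0) (Pi.single j 1, 0) (x, t) * ψ x
      + fderiv ℝ u (x, t) (Pi.single j 1, 0) * fderiv ℝ ψ x (Pi.single j 1)) = 0 := by
  have hv := hu.fderiv_slab_apply (Pi.single j 1, 0)
  have hvt : ContDiff ℝ 1 fun x => fderiv ℝ u (x, t) (Pi.single j 1, 0) :=
    (hv.of_le (by exact_mod_cast le_top)).contDiff_slab_slice ht
  refine Eq.trans (integral_congr_ae (Filter.Eventually.of_forall fun x => ?_))
    (integral_unitBox_fderiv_single_eq_zero (hvt.mul hψ) j fun x => by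
      simp only [hψper, fderiv_add_single_of_periodic hper])
  have h1 : HasFDerivAt (fun q => fderiv ℝ u q (Pi.single j 1, 0))
      (fderiv ℝ (fun q => fderiv ℝ u q (Pi.single j 1, 0)) (x, t)) (x, t) :=
    ((hv.differentiableOn (by simp)).differentiableAt
      ((isOpen_slab n).mem_nhds ht)).hasFDerivAt
  have h2 : HasFDerivAt (fun y => fderiv ℝ u (y, t) (Pi.single j 1, 0)) _ x :=
    HasFDerivAt.comp (f := fun y : Fin n → ℝ => (y, t)) x h1
      ((hasFDerivAt_id (𝕜 := ℝ) x).prodMk (hasFDerivAt_const t x))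
  have h3 : fderiv ℝ (fun y => fderiv ℝ u (y, t) (Pi.single j 1, 0) * ψ y) x = _ :=
    (h2.mul (hψ.differentiable one_ne_zero x).hasFDerivAt).fderiv
  beta_reduce
  rw [h3]
  simp [pd2]
  ring

theorem integral_fluxDensity {n : ℕ} {ε : ℝ} {u : (Fin n → ℝ) × ℝ → ℝ}
    (hu : ContDiffOn ℝ (⊤ : ℕ∞) u (slab n))
    (hper : ∀ (p : (Fin n → ℝ) × ℝ) (i : Fin n), u (p.1 + Pi.single i 1, p.2) = u p)
    {ψ : (Fin n → ℝ) → ℝ} (hψ : ContDiff ℝ 1 ψ)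
    (hψper : ∀ (x : Fin n → ℝ) (i : Fin n), ψ (x + Pi.single i 1) = ψ x)
    {t : ℝ} (ht : t ∈ Set.Ioo (0 : ℝ) 1) :
    ∫ x in unitBox n, fluxDensity ε u ψ (x, t) =
      sWt ε t * (∫ x in unitBox n, fderiv ℝ u (x, t) (0, 1) * ψ x)
        + aWt ε t * ∫ x in unitBox n, pd2 u (0, 1) (0, 1) (x, t) * ψ x := by
  have hdψ : ∀ j : Fin n, Continuous fun x => fderiv ℝ ψ x (Pi.single j 1) := fun j =>
    (hψ.continuous_fderiv one_ne_zero).clm_apply continuous_const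
  have hi1 : IntegrableOn (fun x => fderiv ℝ u (x, t) (0, 1) * ψ x) (unitBox n) :=
    (((continuousOn_fderiv_slab hu (0, 1)).continuous_slab_slice ht).mul
    hψ.continuous).integrableOn_unitBox
  have hi2 : IntegrableOn (fun x => pd2 u (0, 1) (0, 1) (x, t) * ψ x) (unitBox n) :=
    (((continuousOn_pd2_slab hu (0, 1) (0, 1)).continuous_slab_slice ht).mul
    hψ.continuous).integrableOn_unitBox
  have hi3 : ∀ j : Fin n, IntegrableOn (fun x =>
      pd2 u (Pi.single j 1, 0) (Pi.single j 1, 0) (x, t) * ψ x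
      + fderiv ℝ u (x, t) (Pi.single j 1, 0) * fderiv ℝ ψ x (Pi.single j 1)) (unitBox n) :=
    fun j => ((((continuousOn_pd2_slab hu _ _).continuous_slab_slice ht).mul hψ.continuous).add
      (((continuousOn_fderiv_slab hu _).continuous_slab_slice ht).mul
        (hdψ j))).integrableOn_unitBox
  have hz : ∫ x in unitBox n, ∑ j : Fin n,
      (pd2 u (Pi.single j 1, 0) (Pi.single j 1, 0) (x, t) * ψ x
      + fderiv ℝ u (x, t) (Pi.single j 1, 0) * fderiv ℝ ψ x (Pi.single j 1)) = 0 := by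
    rw [integral_finsetSum _ fun j _ => hi3 j]
    exact Finset.sum_eq_zero fun j _ => integral_slice_by_parts hu hper hψ hψper ht j
  have hsum := integrable_finsetSum Finset.univ fun j _ => hi3 j
  have heq : ∀ x, fluxDensity ε u ψ (x, t) =
      sWt ε t * (fderiv ℝ u (x, t) (0, 1) * ψ x) + aWt ε t * (pd2 u (0, 1) (0, 1) (x, t) * ψ x)
      + aWt ε t * ∑ j : Fin n, (pd2 u (Pi.single j 1, 0) (Pi.single j 1, 0) (x, t) * ψ x
        + fderiv ℝ u (x, t) (Pi.single j 1, 0) * fderiv ℝ ψ x (Pi.single j 1)) := by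
    intro x
    simp only [fluxDensity, weightedDiv, Fin.sum_univ_castSucc, dirVec_castSucc, dirVec_last,
      Finset.sum_add_distrib, ← Finset.sum_mul]
    ring
  simp only [heq]
  have hi12 : IntegrableOn (fun x => sWt ε t * (fderiv ℝ u (x, t) (0, 1) * ψ x)
      + aWt ε t * (pd2 u (0, 1) (0, 1) (x, t) * ψ x)) (unitBox n) :=
    (hi1.const_mul _).add (hi2.const_mul _)
  rw [integral_add hi12 (hsum.const_mul _),
    integral_add (hi1.const_mul _) (hi2.const_mul _), integral_const_mul, integral_const_mul,
    integral_const_mul, hz, mul_zero, add_zero]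

/-- The flux through the level surface `x_N = t`, tested against `ψ`. -/
def testedFlux {n : ℕ} (ε : ℝ) (u : (Fin n → ℝ) × ℝ → ℝ) (ψ : (Fin n → ℝ) → ℝ) (t : ℝ) : ℝ :=
  ∫ x in unitBox n, aWt ε t * fderiv ℝ u (x, t) (0, 1) * ψ x

theorem testedFlux_eq {n : ℕ} (ε : ℝ) (u : (Fin n → ℝ) × ℝ → ℝ) (ψ : (Fin n → ℝ) → ℝ) (t : ℝ) :
    testedFlux ε u ψ t = aWt ε t * ∫ x in unitBox n, fderiv ℝ u (x, t) (0, 1) * ψ x := by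
  simp only [testedFlux, mul_assoc, integral_const_mul]

theorem hasDerivAt_testedFlux {n : ℕ} {ε : ℝ} (hε : ε ∈ Set.Ioo (0 : ℝ) (1 / 2))
    {u : (Fin n → ℝ) × ℝ → ℝ} (hu : ContDiffOn ℝ (⊤ : ℕ∞) u (slab n))
    (hper : ∀ (p : (Fin n → ℝ) × ℝ) (i : Fin n), u (p.1 + Pi.single i 1, p.2) = u p)
    {ψ : (Fin n → ℝ) → ℝ} (hψ : ContDiff ℝ 1 ψ)
    (hψper : ∀ (x : Fin n → ℝ) (i : Fin n), ψ (x + Pi.single i 1) = ψ x)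
    {t : ℝ} (ht : t ∈ Set.Ioo 0 ε ∪ Set.Ioo (1 - ε) 1) :
    HasDerivAt (testedFlux ε u ψ) (∫ x in unitBox n, fluxDensity ε u ψ (x, t)) t := by
  have ht1 : t ∈ Set.Ioo (0 : ℝ) 1 := by
    obtain ⟨h0, h1⟩ := hε
    rcases ht with ⟨h2, h3⟩ | ⟨h2, h3⟩ <;> constructor <;> linarith
  rw [integral_fluxDensity hu hper hψ hψper ht1, funext (testedFlux_eq ε u ψ)]
  exact (hasDerivAt_aWt hε ht).mul
    (hasDerivAt_integral_slab_slice (hu.fderiv_slab_apply (0, 1)) hψ.continuous ht1)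

theorem exists_sq_testedFlux_le {n : ℕ} {ε : ℝ} (hε : 0 < ε) {u : (Fin n → ℝ) × ℝ → ℝ}
    (hu : ContDiffOn ℝ (⊤ : ℕ∞) u (slab n)) {ψ : (Fin n → ℝ) → ℝ} (hψ : Continuous ψ) :
    ∃ C : ℝ, ∀ t ∈ Set.Ioo (0 : ℝ) 1, testedFlux ε u ψ t ^ 2 ≤
      aWt ε t * (C * ∫ x in unitBox n, energyDensity ε u (x, t)) := by
  obtain ⟨C, hC⟩ := (isCompact_Icc (a := (0 : Fin n → ℝ)) (b := 1)).exists_bound_of_continuousOn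
    (hψ.pow 2).continuousOn
  refine ⟨C, fun t ht => ?_⟩
  have ha0 := aWt_nonneg hε ht
  have hc := ((continuousOn_fderiv_slab hu (0, 1)).continuous_slab_slice ht).mul hψ
  have h1 := sq_integral_le_integral_sq hc.integrableOn_unitBox (hc.pow 2).integrableOn_unitBox
  have hce := (continuousOn_energyDensity ε hu).continuous_slab_slice ht
  have h2 : aWt ε t * ∫ x in unitBox n, (fderiv ℝ u (x, t) (0, 1) * ψ x) ^ 2
      ≤ C * ∫ x in unitBox n, energyDensity ε u (x, t) := by
    rw [← integral_const_mul, ← integral_const_mul]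
    refine setIntegral_mono_on ((hc.pow 2).integrableOn_unitBox.const_mul _)
      (hce.integrableOn_unitBox.const_mul _) (measurableSet_unitBox n) fun x hx => ?_
    have h3 : ψ x ^ 2 ≤ C := (le_abs_self _).trans (hC x (unitBox_subset_Icc n hx))
    have h4 : aWt ε t * fderiv ℝ u (x, t) (0, 1) ^ 2 ≤ energyDensity ε u (x, t) := by
      refine mul_le_mul_of_nonneg_left ?_ ha0
      rw [Fin.sum_univ_castSucc, dirVec_last]
      exact le_add_of_nonneg_left (Finset.sum_nonneg fun _ _ => sq_nonneg _)
    calc aWt ε t * (fderiv ℝ u (x, t) (0, 1) * ψ x) ^ 2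
        = ψ x ^ 2 * (aWt ε t * fderiv ℝ u (x, t) (0, 1) ^ 2) := by ring
      _ ≤ C * energyDensity ε u (x, t) :=
        mul_le_mul h3 h4 (mul_nonneg ha0 (sq_nonneg _)) ((sq_nonneg _).trans h3)
  rw [testedFlux_eq, mul_pow, sq (aWt ε t), mul_assoc]
  exact mul_le_mul_of_nonneg_left ((mul_le_mul_of_nonneg_left h1 ha0).trans h2) ha0

/-- Vanishing of the natural boundary flux: for a finite-energy `L²` function `u`,
smooth in the open cylinder `Ω = 𝕋^n × (0,1)`, with `div(a_ε∇u) ∈ L²(Ω)`, the flux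
`a_ε ∂u/∂x_N` along the level surfaces `x_N = δ` (resp. `x_N = 1−δ`) tested against any
`C¹` function on the torus tends to `0` as `δ → 0⁺`. -/
theorem boundary_flux_vanishes
    (n : ℕ) (hn : 1 ≤ n) (ε : ℝ) (hε : ε ∈ Set.Ioo (0:ℝ) (1/2))
    (u : (Fin n → ℝ) × ℝ → ℝ)
    (hu : ContDiffOn ℝ (⊤ : ℕ∞) u {p : (Fin n → ℝ) × ℝ | p.2 ∈ Set.Ioo (0:ℝ) 1})
    (hper : ∀ (p : (Fin n → ℝ) × ℝ) (i : Fin n), u (p.1 + Pi.single i 1, p.2) = u p)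
    (hL2 : ∫⁻ p in cyl n, ENNReal.ofReal ((u p) ^ 2) < ⊤)
    (hE : ∫⁻ p in cyl n,
        ENNReal.ofReal (aWt ε p.2 * ∑ i : Fin (n+1), (fderiv ℝ u p (dirVec n i)) ^ 2) < ⊤)
    (hdiv : ∫⁻ p in cyl n,
        ENNReal.ofReal ((aWt ε p.2 * (∑ i : Fin (n+1), pd2 u (dirVec n i) (dirVec n i) p)
          + sWt ε p.2 * fderiv ℝ u p ((0 : Fin n → ℝ), (1:ℝ))) ^ 2) < ⊤)
    (ψ : (Fin n → ℝ) → ℝ) (hψ : ContDiff ℝ 1 ψ)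
    (hψper : ∀ (x : Fin n → ℝ) (i : Fin n), ψ (x + Pi.single i 1) = ψ x) :
    Filter.Tendsto
        (fun δ => ∫ x' in unitBox n,
          aWt ε δ * fderiv ℝ u (x', δ) ((0 : Fin n → ℝ), (1:ℝ)) * ψ x')
        (nhdsWithin 0 (Set.Ioi 0)) (nhds 0) ∧
      Filter.Tendsto
        (fun δ => ∫ x' in unitBox n,
          aWt ε (1 - δ) * fderiv ℝ u (x', 1 - δ) ((0 : Fin n → ℝ), (1:ℝ)) * ψ x')
        (nhdsWithin 0 (Set.Ioi 0)) (nhds 0) := by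
  have hε0 := hε.1
  have hε1 := hε.2
  have hu' : ContDiffOn ℝ (⊤ : ℕ∞) u (slab n) := hu
  have hEi : IntegrableOn (energyDensity ε u) (cyl n) :=
    integrableOn_of_lintegral_ofReal_lt_top (measurableSet_cyl n)
      (continuousOn_energyDensity ε hu').aestronglyMeasurable_cyl
      (fun p hp => energyDensity_nonneg hε0 u (cyl_subset_slab n hp)) hE
  have hDi : IntegrableOn (fun p => weightedDiv ε u p ^ 2) (cyl n) :=
    integrableOn_of_lintegral_ofReal_lt_top (measurableSet_cyl n)
      ((aestronglyMeasurable_weightedDiv ε hu').pow 2) (fun p _ => sq_nonneg _) hdiv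
  have hH := integrableOn_slice_integral (integrableOn_fluxDensity hε0 hu' hEi hDi hψ)
  have hK := integrableOn_slice_integral hEi
  obtain ⟨C, hC⟩ := exists_sq_testedFlux_le (ε := ε) hε0 hu' hψ.continuous
  have hK0 : ∀ t ∈ Set.Ioo (0 : ℝ) 1, 0 ≤ aWt ε t → ∀ r, aWt ε t ≤ r / ε →
      testedFlux ε u ψ t ^ 2 ≤
        r * (|C| / ε * ∫ x in unitBox n, energyDensity ε u (x, t)) := by
    intro t ht ha r hr
    have hk : 0 ≤ ∫ x in unitBox n, energyDensity ε u (x, t) :=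
      integral_nonneg fun x => energyDensity_nonneg hε0 u ht
    calc testedFlux ε u ψ t ^ 2
        ≤ aWt ε t * (C * ∫ x in unitBox n, energyDensity ε u (x, t)) := hC t ht
      _ ≤ (r / ε) * (|C| * ∫ x in unitBox n, energyDensity ε u (x, t)) := by
        refine (mul_le_mul_of_nonneg_left
          (mul_le_mul_of_nonneg_right (le_abs_self C) hk) ha).trans ?_
        exact mul_le_mul_of_nonneg_right hr (by positivity)
      _ = _ := by ring
  have hreflect : ∀ f : ℝ → ℝ, IntegrableOn f (Set.Ioo (0 : ℝ) 1) →
      IntegrableOn (fun t => f (1 - t)) (Set.Ioo (0 : ℝ) ε) := by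
    intro f hf
    have h := ((Measure.measurePreserving_sub_left volume (1 : ℝ)).integrableOn_comp_preimage
      (MeasurableEquiv.subLeft (1 : ℝ)).measurableEmbedding).2 hf
    refine h.mono_set fun t ht => ?_
    have h1 := ht.1
    have h2 := ht.2
    constructor <;> linarith
  have hsub : Set.Ioo 0 ε ⊆ Set.Ioo (0 : ℝ) 1 := Set.Ioo_subset_Ioo_right (by linarith)
  constructor
  · exact tendsto_zero_of_hasDerivAt_of_sq_le hε0
      (fun t ht => hasDerivAt_testedFlux hε hu' hper hψ hψper (Or.inl ht))
      (hH.mono_set hsub) ((hK.mono_set hsub).const_mul (|C| / ε))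
      (fun t ht => hK0 t (hsub ht) (aWt_nonneg hε0 (hsub ht)) t (min_le_left _ _))
  · have hmem : ∀ t ∈ Set.Ioo 0 ε, 1 - t ∈ Set.Ioo (1 - ε) 1 := fun t ht =>
      ⟨by linarith [ht.2], by linarith [ht.1]⟩
    have hmem' : ∀ t ∈ Set.Ioo 0 ε, 1 - t ∈ Set.Ioo (0 : ℝ) 1 := fun t ht =>
      ⟨by linarith [ht.2], by linarith [ht.1]⟩
    refine tendsto_zero_of_hasDerivAt_of_sq_le (F := fun t => testedFlux ε u ψ (1 - t)) hε0
      (fun t ht => HasDerivAt.comp_const_sub 1 t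
        (hasDerivAt_testedFlux hε hu' hper hψ hψper (Or.inr (hmem t ht))))
      (hreflect _ hH).neg ((hreflect _ hK).const_mul (|C| / ε)) fun t ht => ?_
    refine hK0 (1 - t) (hmem' t ht) (aWt_nonneg hε0 (hmem' t ht)) t ?_
    have h : aWt ε (1 - t) ≤ (1 - (1 - t)) / ε := (min_le_right _ _).trans (min_le_left _ _)
    rwa [sub_sub_cancel] at h
end
end
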